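/- arXiv:2401.05588 — 6 statements merged into one kernel-verified Lean document; each statement's English description precedes it below -/
import Mathlib

section
/- Let F be a field, g a Lie algebra over F, and M a left g-module. Then the left hemi-semidirect product g ⋉_ℓ M is a semi-simple left Leibniz algebra if, and only if, g is a semi-simple Lie algebra and gM = M. -/
universe u v w

section LeibnizDefs

variable (F : Type v) [Field F] {L : Type u} [AddCommGroup L] [Module F L]

/-- The Leibniz kernel `Leib(L) = span_F {x² : x ∈ L}` of a (Leibniz) multiplication. -/
def leibKer (mul : L → L → L) : Submodule F L :=
  Submodule.span F {z : L | ∃ x : L, z = mul x x}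

/-- The derived subalgebra `L² = span_F {xy : x, y ∈ L}`. -/
def derivedSub (mul : L → L → L) : Submodule F L :=
  Submodule.span F {z : L | ∃ x y : L, z = mul x y}

/-- A (two-sided) ideal of an algebra with multiplication `mul`. -/
def IsIdealOf (mul : L → L → L) (I : Submodule F L) : Prop :=
  ∀ x : L, ∀ a ∈ I, mul x a ∈ I ∧ mul a x ∈ I

/-- The derived series of a subspace: `I⁽⁰⁾ = I`, `I⁽ⁿ⁺¹⁾ = span {ab : a, b ∈ I⁽ⁿ⁾}`. -/
def derSeries (mul : L → L → L) (I : Submodule F L) : ℕ → Submodule F L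
  | 0 => I
  | n + 1 => Submodule.span F
      {z : L | ∃ a ∈ derSeries mul I n, ∃ b ∈ derSeries mul I n, z = mul a b}

/-- A subspace is solvable if its derived series vanishes eventually. -/
def IsSolvableSub (mul : L → L → L) (I : Submodule F L) : Prop :=
  ∃ n : ℕ, derSeries F mul I n = ⊥

/-- A left Leibniz algebra is semi-simple if every solvable ideal is contained
in its Leibniz kernel. -/
def IsSemisimpleLeibniz (mul : L → L → L) : Prop :=
  ∀ I : Submodule F L, IsIdealOf F mul I → IsSolvableSub F mul I → I ≤ leibKer F mul

/-- A left Leibniz algebra is Lie-simple if the only ideals containing `Leib(L)`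
are `Leib(L)` and `L`, and `Leib(L) ⊊ L²`. -/
def IsLieSimpleLeibniz (mul : L → L → L) : Prop :=
  (∀ I : Submodule F L, IsIdealOf F mul I → leibKer F mul ≤ I →
      I = leibKer F mul ∨ I = ⊤) ∧ leibKer F mul < derivedSub F mul

/-- A left Leibniz algebra is simple if its only ideals are `0`, `Leib(L)` and `L`,
and `Leib(L) ⊊ L²`. -/
def IsSimpleLeibniz (mul : L → L → L) : Prop :=
  (∀ I : Submodule F L, IsIdealOf F mul I →
      I = ⊥ ∨ I = leibKer F mul ∨ I = ⊤) ∧ leibKer F mul < derivedSub F mul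

/-- A non-abelian algebra whose only ideals are `0` and the whole algebra. -/
def IsSimpleMul (mul : L → L → L) : Prop :=
  (∃ x y : L, mul x y ≠ 0) ∧
  ∀ I : Submodule F L, IsIdealOf F mul I → I = ⊥ ∨ I = ⊤

/-- The multiplication is bilinear over `F`. -/
def IsBilinearMul (mul : L → L → L) : Prop :=
  (∀ x y z : L, mul (x + y) z = mul x z + mul y z) ∧
  (∀ x y z : L, mul x (y + z) = mul x y + mul x z) ∧
  (∀ (c : F) (x y : L), mul (c • x) y = c • mul x y) ∧
  (∀ (c : F) (x y : L), mul x (c • y) = c • mul x y)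

/-- The left Leibniz identity `x(yz) = (xy)z + y(xz)`. -/
def IsLeftLeibnizMul (mul : L → L → L) : Prop :=
  ∀ x y z : L, mul x (mul y z) = mul (mul x y) z + mul y (mul x z)

end LeibnizDefs

section LieDefs

variable (F : Type v) [Field F] (g : Type u) [LieRing g] [LieAlgebra F g]

/-- A Lie algebra is semi-simple if its only solvable ideal is `0`. -/
def IsSemisimpleLieDef : Prop :=
  ∀ I : Submodule F g, IsIdealOf F (fun x y : g => ⁅x, y⁆) I →
    IsSolvableSub F (fun x y : g => ⁅x, y⁆) I → I = ⊥

/-- A Lie algebra is simple if it is non-abelian and its only ideals are `0` and `g`. -/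
def IsSimpleLieDef : Prop :=
  IsSimpleMul F (fun x y : g => ⁅x, y⁆)

end LieDefs

section ModuleDefs

variable (F : Type v) [Field F] (g : Type u) [LieRing g] [LieAlgebra F g]
  (M : Type w) [AddCommGroup M] [Module F M] [LieRingModule g M] [LieModule F g M]

/-- `gM := span_F {x·m : x ∈ g, m ∈ M}`. -/
def gModSpan : Submodule F M :=
  Submodule.span F {m : M | ∃ (x : g) (n : M), m = ⁅x, n⁆}

/-- A subspace of `M` that is stable under the `g`-action. -/
def IsLieSubmoduleOf (N : Submodule F M) : Prop :=
  ∀ x : g, ∀ n ∈ N, ⁅x, n⁆ ∈ N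

/-- `M` is an irreducible `g`-module: `M ≠ 0` and its only `g`-submodules are `0` and `M`. -/
def IsIrreducibleLieModule : Prop :=
  (∃ m : M, m ≠ 0) ∧
  ∀ N : Submodule F M, IsLieSubmoduleOf F g M N → N = ⊥ ∨ N = ⊤

/-- `M` is completely reducible: every `g`-submodule has a `g`-invariant complement. -/
def IsCompletelyReducibleLieModule : Prop :=
  ∀ N : Submodule F M, IsLieSubmoduleOf F g M N →
    ∃ N' : Submodule F M, IsLieSubmoduleOf F g M N' ∧ N ⊓ N' = ⊥ ∧ N ⊔ N' = ⊤

/-- `M` contains no non-zero trivial `g`-submodule. -/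
def HasNoTrivialLieSubmodule : Prop :=
  ∀ N : Submodule F M, IsLieSubmoduleOf F g M N →
    (∀ x : g, ∀ n ∈ N, ⁅x, n⁆ = (0 : M)) → N = ⊥

end ModuleDefs

/-- The multiplication `(x, m)(y, n) := ([x, y], x·n)` of the left hemi-semidirect
product `g ⋉_ℓ M`. -/
def hemiMul {g : Type u} {M : Type w} [LieRing g] [AddCommGroup M]
    [LieRingModule g M] (a b : g × M) : g × M :=
  (⁅a.1, b.1⁆, ⁅a.1, b.2⁆)

theorem leibKer_hemi_aux (F : Type v) [Field F]
    (g : Type u) [LieRing g] [LieAlgebra F g]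
    (M : Type w) [AddCommGroup M] [Module F M] [LieRingModule g M] [LieModule F g M] :
    leibKer F (hemiMul (g := g) (M := M)) = Submodule.prod ⊥ (gModSpan F g M) := by
  apply le_antisymm
  · refine Submodule.span_le.2 ?_
    rintro _ ⟨x, rfl⟩
    refine Submodule.mem_prod.2 ⟨?_, ?_⟩
    · simp [hemiMul]
    · exact Submodule.subset_span ⟨x.1, x.2, rfl⟩
  · have h : gModSpan F g M ≤
        (leibKer F (hemiMul (g := g) (M := M))).comap (LinearMap.inr F g M) := by
      refine Submodule.span_le.2 ?_
      rintro _ ⟨x, n, rfl⟩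
      refine Submodule.subset_span ⟨(x, n), ?_⟩
      simp [hemiMul]
    rintro ⟨a, b⟩ hab
    obtain ⟨ha, hb⟩ := Submodule.mem_prod.1 hab
    have ha' : a = 0 := by simpa using ha
    subst ha'
    exact h hb

theorem derSeries_hemi_aux (F : Type v) [Field F]
    (g : Type u) [LieRing g] [LieAlgebra F g]
    (M : Type w) [AddCommGroup M] [Module F M] [LieRingModule g M] [LieModule F g M]
    (I : Submodule F g) (n : ℕ) :
    derSeries F (hemiMul (g := g) (M := M)) (I.prod ⊤) n ≤
      (derSeries F (fun x y : g => ⁅x, y⁆) I n).prod ⊤ := by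
  induction n with
  | zero => exact le_rfl
  | succ n ih =>
    refine Submodule.span_le.2 ?_
    rintro _ ⟨a, ha, b, hb, rfl⟩
    exact Submodule.mem_prod.2 ⟨Submodule.subset_span
      ⟨a.1, (Submodule.mem_prod.1 (ih ha)).1, b.1, (Submodule.mem_prod.1 (ih hb)).1, rfl⟩,
      Submodule.mem_top⟩

theorem derSeries_fst_aux (F : Type v) [Field F]
    (g : Type u) [LieRing g] [LieAlgebra F g]
    (M : Type w) [AddCommGroup M] [Module F M] [LieRingModule g M] [LieModule F g M]
    (I : Submodule F (g × M)) (n : ℕ) :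
    derSeries F (fun x y : g => ⁅x, y⁆) (I.map (LinearMap.fst F g M)) n ≤
      (derSeries F (hemiMul (g := g) (M := M)) I n).map (LinearMap.fst F g M) := by
  induction n with
  | zero => exact le_rfl
  | succ n ih =>
    refine Submodule.span_le.2 ?_
    rintro _ ⟨a, ha, b, hb, rfl⟩
    obtain ⟨a', ha', rfl⟩ := ih ha
    obtain ⟨b', hb', rfl⟩ := ih hb
    exact ⟨hemiMul a' b', Submodule.subset_span ⟨a', ha', b', hb', rfl⟩, rfl⟩

theorem prod_solvable_aux (F : Type v) [Field F]
    (g : Type u) [LieRing g] [LieAlgebra F g]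
    (M : Type w) [AddCommGroup M] [Module F M] [LieRingModule g M] [LieModule F g M]
    (h : IsSemisimpleLeibniz F (hemiMul (g := g) (M := M)))
    (I : Submodule F g) (hI : IsIdealOf F (fun x y : g => ⁅x, y⁆) I)
    (hs : IsSolvableSub F (fun x y : g => ⁅x, y⁆) I) :
    I.prod ⊤ ≤ Submodule.prod ⊥ (gModSpan F g M) := by
  rw [← leibKer_hemi_aux]
  refine h _ ?_ ?_
  · intro x a ha
    have := hI x.1 a.1 (Submodule.mem_prod.1 ha).1
    exact ⟨Submodule.mem_prod.2 ⟨this.1, Submodule.mem_top⟩,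
      Submodule.mem_prod.2 ⟨this.2, Submodule.mem_top⟩⟩
  · obtain ⟨n, hn⟩ := hs
    refine ⟨n + 1, ?_⟩
    rw [eq_bot_iff]
    refine Submodule.span_le.2 ?_
    rintro _ ⟨a, ha, b, hb, rfl⟩
    have h1 := (Submodule.mem_prod.1 (derSeries_hemi_aux F g M I n ha)).1
    rw [hn, Submodule.mem_bot] at h1
    simp [hemiMul, h1]

/-- `g ⋉_ℓ M` is a semi-simple left Leibniz algebra if, and only if,
`g` is a semi-simple Lie algebra and `gM = M`. -/
theorem hemiSemidirectProduct_semisimple_iff (F : Type v) [Field F]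
    (g : Type u) [LieRing g] [LieAlgebra F g]
    (M : Type w) [AddCommGroup M] [Module F M] [LieRingModule g M] [LieModule F g M] :
    IsSemisimpleLeibniz F (hemiMul (g := g) (M := M)) ↔
      IsSemisimpleLieDef F g ∧ gModSpan F g M = ⊤ := by
  constructor
  · intro h
    constructor
    · intro I hI hs
      rw [eq_bot_iff]
      intro a ha
      have := prod_solvable_aux F g M h I hI hs
        (Submodule.mem_prod.2 ⟨ha, Submodule.mem_top⟩ : (a, (0 : M)) ∈ I.prod ⊤)
      exact (Submodule.mem_prod.1 this).1
    · rw [eq_top_iff]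
      intro m _
      have := prod_solvable_aux F g M h ⊥ (by
          intro x a ha
          rw [Submodule.mem_bot] at ha
          subst ha
          simp) ⟨0, rfl⟩
        (Submodule.mem_prod.2 ⟨Submodule.zero_mem _, Submodule.mem_top⟩ :
          ((0 : g), m) ∈ (⊥ : Submodule F g).prod ⊤)
      exact (Submodule.mem_prod.1 this).2
  · rintro ⟨hg, hM⟩ I hI ⟨n, hn⟩
    rw [leibKer_hemi_aux, hM]
    have h0 : I.map (LinearMap.fst F g M) = ⊥ := by
      refine hg _ ?_ ⟨n, ?_⟩
      · rintro x _ ⟨a, ha, rfl⟩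
        exact ⟨⟨_, (hI (x, 0) a ha).1, rfl⟩, ⟨_, (hI (x, 0) a ha).2, rfl⟩⟩
      · rw [eq_bot_iff]
        refine (derSeries_fst_aux F g M I n).trans ?_
        rw [hn, Submodule.map_bot]
    intro a ha
    refine Submodule.mem_prod.2 ⟨?_, Submodule.mem_top⟩
    rw [← h0]
    exact ⟨a, ha, rfl⟩
end

section
/- Let F be a field of characteristic zero and let L be a left Leibniz algebra over F. Then L is finite-dimensional and semi-simple if, and only if, there exist a finite-dimensional semi-simple Lie algebra g over F and a finite-dimensional completely reducible left g-module M containing no non-zero trivial g-submodule such that L is isomorphic to the left hemi-semidirect product g ⋉_ℓ M (i.e., there is an F-linear bijection L → g × M carrying the multiplication of L to the multiplication of g ⋉_ℓ M). -/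
universe u v w

section WeylHelpers
open LieAlgebra LieModule
set_option linter.unusedSectionVars false
attribute [local instance 100] LieRing.ofAssociativeRing

theorem wh_nilp {F V : Type*} [Field F] [CharZero F] [AddCommGroup V] [Module F V]
    [FiniteDimensional F V] (T : Module.End F V)
    (h : ∀ n : ℕ, LinearMap.trace F V (T ^ (n + 1)) = 0) : IsNilpotent T := by
  have hp : minpoly F T ≠ 0 := minpoly.ne_zero (Algebra.IsIntegral.isIntegral T)
  obtain ⟨k, q, hq, hpq⟩ := WfDvdMonoid.max_power_factor hp Polynomial.irreducible_X
  have hco : IsCoprime (Polynomial.X ^ (k + 1) : Polynomial F) q :=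
    ((Polynomial.irreducible_X.coprime_iff_not_dvd).2 hq).pow_left
  obtain ⟨a, b, hab⟩ := hco
  have hz : Polynomial.aeval T (Polynomial.X ^ k * q) = 0 := by
    rw [← hpq]; exact minpoly.aeval F T
  set E := Polynomial.aeval T (a * Polynomial.X ^ (k + 1)) with hE
  have h1 : E + Polynomial.aeval T (b * q) = 1 := by
    rw [hE, ← map_add, hab, map_one]
  have h2 : E * Polynomial.aeval T (b * q) = 0 := by
    rw [hE, ← map_mul]
    have : a * Polynomial.X ^ (k + 1) * (b * q) =
      (a * Polynomial.X * b) * (Polynomial.X ^ k * q) := by ring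
    rw [this, map_mul, hz, mul_zero]
  have hid : IsIdempotentElem E := by
    have : E * (E + Polynomial.aeval T (b * q)) = E := by rw [h1, mul_one]
    rwa [mul_add, h2, add_zero] at this
  have htr : LinearMap.trace F V E = 0 := by
    have hgen : ∀ c : Polynomial F,
        LinearMap.trace F V (Polynomial.aeval T (c * Polynomial.X ^ (k + 1))) = 0 := by
      intro c
      induction c using Polynomial.induction_on' with
      | add p q hp hq => rw [add_mul, map_add, map_add, hp, hq, add_zero]
      | monomial n r =>
        rw [← Polynomial.C_mul_X_pow_eq_monomial, mul_assoc, ← pow_add, map_mul,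
          Polynomial.aeval_C, map_pow, Polynomial.aeval_X, ← Algebra.smul_def, map_smul,
          ← add_assoc, h, smul_zero]
    exact hgen a
  have hE0 : E = 0 := by
    have hproj := LinearMap.IsIdempotentElem.isProj_range E hid
    have := LinearMap.IsProj.trace hproj
    rw [htr] at this
    have h0 : Module.finrank F (LinearMap.range E) = 0 := by exact_mod_cast this.symm
    exact LinearMap.range_eq_bot.1 (Submodule.finrank_eq_zero.1 h0)
  refine ⟨k, ?_⟩
  rw [hE0, zero_add] at h1
  have : Polynomial.aeval T (Polynomial.X ^ k * (b * q)) = T ^ k := by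
    rw [map_mul, h1, mul_one, map_pow, Polynomial.aeval_X]
  rw [← this, mul_left_comm, map_mul, hz, mul_zero]

variable {F : Type*} {g : Type*} [Field F] [CharZero F] [LieRing g] [LieAlgebra F g]
  [FiniteDimensional F g] [IsKilling F g]

variable (F g) in
theorem wh_perfect : derivedSeries F g 1 = ⊤ := by
  have hc := LieIdeal.isCompl_killingCompl (derivedSeries F g 1)
  set I := derivedSeries F g 1 with hI
  have hab : IsLieAbelian (LieIdeal.killingCompl F g I) := by
    rw [LieSubmodule.lie_abelian_iff_lie_self_eq_bot, LieSubmodule.lie_eq_bot_iff]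
    intro x hx y hy
    have h1 : ⁅x, y⁆ ∈ I := by
      rw [hI, LieAlgebra.derivedSeries_def, derivedSeriesOfIdeal_succ]
      exact LieSubmodule.lie_mem_lie (LieSubmodule.mem_top x) (LieSubmodule.mem_top y)
    have h2 : ⁅x, y⁆ ∈ LieIdeal.killingCompl F g I := lie_mem_right F g _ x y hy
    have : ⁅x, y⁆ ∈ I ⊓ LieIdeal.killingCompl F g I := ⟨h1, h2⟩
    rw [hc.inf_eq_bot] at this
    simpa using this
  have := IsKilling.ideal_eq_bot_of_isLieAbelian (LieIdeal.killingCompl F g I)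
  have h3 := hc.sup_eq_top
  rwa [this, sup_bot_eq] at h3

variable (F g) in
/-- dual bases for the Killing form -/
theorem wh_dual : ∃ (n : ℕ) (b c : Module.Basis (Fin n) F g),
    (∀ x, x = ∑ j, killingForm F g x (c j) • b j) ∧
    (∀ x, x = ∑ j, killingForm F g (b j) x • c j) ∧
    (∀ x j, b.repr x j = killingForm F g x (c j)) := by
  let b := Module.finBasis F g
  have hnd := IsKilling.killingForm_nondegenerate F g
  have hs : (killingForm F g).IsSymm := ⟨fun x y => LieModule.traceForm_comm F g g x y⟩
  let c := LinearMap.BilinForm.dualBasis (killingForm F g) hnd b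
  have hr : ∀ x j, b.repr x j = killingForm F g x (c j) := by
    intro x j
    have : LinearMap.BilinForm.dualBasis (killingForm F g) hnd c = b :=
      LinearMap.BilinForm.dualBasis_dualBasis hnd hs b
    rw [← this, LinearMap.BilinForm.dualBasis_repr_apply]
  refine ⟨_, b, c, fun x => ?_, fun x => ?_, hr⟩
  · conv_lhs => rw [← b.sum_repr x]
    refine Finset.sum_congr rfl fun j _ => ?_
    rw [hr]
  · conv_lhs => rw [← c.sum_repr x]
    refine Finset.sum_congr rfl fun j _ => ?_
    congr 1
    rw [LinearMap.BilinForm.dualBasis_repr_apply]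
    exact LieModule.traceForm_comm F g g _ _

theorem wh_inv {n : ℕ} (b c : Module.Basis (Fin n) F g)
    (hb : ∀ x, x = ∑ j, killingForm F g x (c j) • b j)
    (hc : ∀ x, x = ∑ j, killingForm F g (b j) x • c j)
    {V : Type*} [AddCommGroup V] [Module F V] (B : g →ₗ[F] g →ₗ[F] V) (x : g) :
    ∑ i, (B ⁅x, b i⁆ (c i) + B (b i) ⁅x, c i⁆) = 0 := by
  have h1 : ∀ i, B ⁅x, b i⁆ (c i) = ∑ j, killingForm F g ⁅x, b i⁆ (c j) • B (b j) (c i) := by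
    intro i
    conv_lhs => rw [hb ⁅x, b i⁆]
    simp [LinearMap.sum_apply]
  have h2 : ∀ i, B (b i) ⁅x, c i⁆ = ∑ j, killingForm F g (b j) ⁅x, c i⁆ • B (b i) (c j) := by
    intro i
    conv_lhs => rw [hc ⁅x, c i⁆]
    simp
  rw [Finset.sum_add_distrib, Finset.sum_congr rfl (fun i _ => h1 i),
    Finset.sum_congr rfl (fun i _ => h2 i), Finset.sum_comm, ← Finset.sum_add_distrib]
  refine Finset.sum_eq_zero fun i _ => ?_
  rw [← Finset.sum_add_distrib]
  refine Finset.sum_eq_zero fun j _ => ?_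
  have := LieModule.traceForm_apply_lie_apply' F g g x (b j) (c i)
  rw [show killingForm F g ⁅x, b j⁆ (c i) = - killingForm F g (b j) ⁅x, c i⁆ from this]
  simp

variable {V : Type*} [AddCommGroup V] [Module F V] [LieRingModule g V] [LieModule F g V]
  [FiniteDimensional F V]

theorem wh_T : ∃ T : Module.End F g,
    (∀ x y, killingForm F g (T x) y = traceForm F g V x y) ∧
    (∀ x y : g, T ⁅x, y⁆ = ⁅x, T y⁆) := by
  have hnd := IsKilling.killingForm_nondegenerate F g
  let e := LinearMap.BilinForm.toDual (killingForm F g) hnd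
  let T : Module.End F g := e.symm.toLinearMap ∘ₗ traceForm F g V
  have h1 : ∀ x y, killingForm F g (T x) y = traceForm F g V x y := by
    intro x y
    rw [← LinearMap.BilinForm.toDual_def hnd]
    change e (e.symm (traceForm F g V x)) y = _
    rw [LinearEquiv.apply_symm_apply]
  refine ⟨T, h1, fun x y => ?_⟩
  have h2 : ∀ z, killingForm F g (T ⁅x, y⁆ - ⁅x, T y⁆) z = 0 := by
    intro z
    rw [map_sub, LinearMap.sub_apply, h1, traceForm_apply_lie_apply',
      show killingForm F g ⁅x, T y⁆ z = - killingForm F g (T y) ⁅x, z⁆ from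
        traceForm_apply_lie_apply' F g g x (T y) z, h1, sub_self]
  exact sub_eq_zero.1 (hnd.1 _ h2)

theorem wh_T_zero (T : Module.End F g) (hT : ∀ x y : g, T ⁅x, y⁆ = ⁅x, T y⁆) (hn : IsNilpotent T) :
    T = 0 := by
  have hnd := IsKilling.killingForm_nondegenerate F g
  have hco : ∀ x, Commute T (ad F g x) := by
    intro x
    ext y
    exact hT x y
  ext x
  refine hnd.1 _ fun y => ?_
  have had : ad F g (T x) = T * ad F g x := by
    ext z
    change ⁅T x, z⁆ = T ⁅x, z⁆
    rw [← lie_skew, ← hT, ← lie_skew x z, map_neg]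
  rw [killingForm_apply_apply, had]
  have : IsNilpotent (T * (ad F g x * ad F g y)) :=
    ((hco x).mul_right (hco y)).isNilpotent_mul_right hn
  exact (LinearMap.isNilpotent_trace_of_isNilpotent this).eq_zero

theorem wh_irr_trivial [Nontrivial V] (hirr : ∀ N : LieSubmodule F g V, N = ⊥ ∨ N = ⊤)
    (h : IsNilpotent (LieAlgebra.derivedSeries F g 1) V)
    (hp : LieAlgebra.derivedSeries F g 1 = ⊤) (x : g) (v : V) : ⁅x, v⁆ = 0 := by
  obtain ⟨⟨m, hm⟩, hm0⟩ := @exists_ne _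
    (nontrivial_max_triv_of_isNilpotent F (LieAlgebra.derivedSeries F g 1) V) 0
  have hm' : ∀ x : g, ⁅x, m⁆ = 0 := by
    intro x
    have hx : x ∈ LieAlgebra.derivedSeries F g 1 := by rw [hp]; trivial
    exact (mem_maxTrivSubmodule F _ V m).1 hm ⟨x, hx⟩
  have hmem : m ∈ maxTrivSubmodule F g V := (mem_maxTrivSubmodule F g V m).2 hm'
  rcases hirr (maxTrivSubmodule F g V) with h0 | h0
  · rw [h0] at hmem
    exact absurd (Subtype.ext (by simpa using hmem)) hm0
  · have : v ∈ maxTrivSubmodule F g V := by rw [h0]; trivial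
    exact (mem_maxTrivSubmodule F g V v).1 this x

theorem wh_irr [Nontrivial V] (hirr : ∀ N : LieSubmodule F g V, N = ⊥ ∨ N = ⊤)
    (d : g →ₗ[F] V) (hd : ∀ x y, d ⁅x, y⁆ = ⁅x, d y⁆ - ⁅y, d x⁆) :
    ∃ v : V, ∀ x, d x = ⁅x, v⁆ := by
  by_cases hβ : traceForm F g V = 0
  · have htriv := wh_irr_trivial hirr (isNilpotent_derivedSeries_of_traceForm_eq_zero hβ)
      (wh_perfect F g)
    refine ⟨0, fun x => ?_⟩
    have hx : x ∈ (LieAlgebra.derivedSeries F g 1).toSubmodule := by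
      rw [wh_perfect F g]; trivial
    have hs : (LieAlgebra.derivedSeries F g 1).toSubmodule =
      Submodule.span F {⁅x, y⁆ | (x : g) (y : g)} := coe_derivedSeries_one_eq F g
    rw [hs] at hx
    rw [lie_zero]
    induction hx using Submodule.span_induction with
    | mem z hz => obtain ⟨a, b, rfl⟩ := hz; rw [hd, htriv, htriv, sub_zero]
    | zero => simp
    | add a b _ _ ha hb => rw [map_add, ha, hb, add_zero]
    | smul c a _ ha => rw [map_smul, ha, smul_zero]
  obtain ⟨T, hT1, hT2⟩ := wh_T (F := F) (g := g) (V := V)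
  obtain ⟨n, b, c, hb, hc, hr⟩ := wh_dual F g
  have hTn : ¬ IsNilpotent T := by
    intro hn
    have := wh_T_zero T hT2 hn
    apply hβ
    ext x y
    rw [← hT1, this]; simp
  have : ∃ k : ℕ, LinearMap.trace F g (T ^ (k + 1)) ≠ 0 := by
    by_contra hcon
    push Not at hcon
    exact hTn (wh_nilp T hcon)
  obtain ⟨k, hk⟩ := this
  set S := T ^ k with hS
  have hSe : ∀ x y : g, S ⁅x, y⁆ = ⁅x, S y⁆ := by
    intro x y
    have hco : Commute T (ad F g x) := by
      ext y
      exact hT2 x y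
    exact LinearMap.congr_fun (hco.pow_left k) y
  let C : Module.End F V := ∑ i, toEnd F g V (S (b i)) * toEnd F g V (c i)
  have hCapp : ∀ v, C v = ∑ i, ⁅S (b i), ⁅c i, v⁆⁆ := by
    intro v; simp [C, LinearMap.sum_apply]
  have hCtr : LinearMap.trace F V C ≠ 0 := by
    have : LinearMap.trace F V C = LinearMap.trace F g (T ^ (k + 1)) := by
      rw [LinearMap.trace_eq_matrix_trace F b, Matrix.trace, map_sum]
      refine Finset.sum_congr rfl fun i _ => ?_
      rw [Matrix.diag_apply, LinearMap.toMatrix_apply, hr, pow_succ']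
      exact (hT1 (S (b i)) (c i)).symm
    rwa [this]
  -- C commutes with the action
  have hCcomm : ∀ (x : g) v, C ⁅x, v⁆ = ⁅x, C v⁆ := by
    intro x v
    let B : g →ₗ[F] g →ₗ[F] V := LinearMap.mk₂ F (fun y z => ⁅S y, ⁅z, v⁆⁆)
      (by intros; simp) (by intros; simp) (by intros; simp) (by intros; simp)
    have h := wh_inv b c hb hc B x
    rw [hCapp, hCapp, lie_sum, ← sub_eq_zero, ← Finset.sum_sub_distrib, ← neg_eq_zero, ← h,
      ← Finset.sum_neg_distrib]
    refine Finset.sum_congr rfl fun i _ => ?_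
    change _ = ⁅S ⁅x, b i⁆, ⁅c i, v⁆⁆ + ⁅S (b i), ⁅⁅x, c i⁆, v⁆⁆
    rw [hSe, lie_lie, lie_lie x (c i), lie_sub]
    abel
  have hCd : ∀ x, C (d x) = ⁅x, ∑ i, ⁅S (b i), d (c i)⁆⁆ := by
    intro x
    let B : g →ₗ[F] g →ₗ[F] V := LinearMap.mk₂ F (fun y z => ⁅S y, d z⁆)
      (by intros; simp) (by intros; simp) (by intros; simp) (by intros; simp)
    have h := wh_inv b c hb hc B x
    rw [hCapp, lie_sum, ← sub_eq_zero, ← Finset.sum_sub_distrib, ← neg_eq_zero, ← h,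
      ← Finset.sum_neg_distrib]
    refine Finset.sum_congr rfl fun i _ => ?_
    change _ = ⁅S ⁅x, b i⁆, d (c i)⁆ + ⁅S (b i), d ⁅x, c i⁆⁆
    rw [hSe, lie_lie, hd, lie_sub]
    abel
  let K : LieSubmodule F g V :=
    { LinearMap.ker C with
      lie_mem := by
        intro x m hm
        change C ⁅x, m⁆ = 0
        rw [hCcomm, show C m = 0 from hm, lie_zero] }
  have hK : LinearMap.ker C = ⊥ := by
    rcases hirr K with h0 | h0
    · exact congrArg LieSubmodule.toSubmodule h0
    · exfalso
      apply hCtr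
      have : C = 0 := LinearMap.ker_eq_top.1 (congrArg LieSubmodule.toSubmodule h0)
      rw [this, map_zero]
  have hinj : Function.Injective C := LinearMap.ker_eq_bot.1 hK
  obtain ⟨v, hv⟩ := (LinearMap.injective_iff_surjective.1 hinj) (∑ i, ⁅S (b i), d (c i)⁆)
  refine ⟨v, fun x => hinj ?_⟩
  rw [hCd, hCcomm, hv]

theorem wh_one_aux (F : Type*) (g : Type*) [Field F] [CharZero F] [LieRing g] [LieAlgebra F g]
    [FiniteDimensional F g] [IsKilling F g] (n : ℕ) :
    ∀ (V : Type w) [AddCommGroup V] [Module F V] [LieRingModule g V] [LieModule F g V]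
    [FiniteDimensional F V], Module.finrank F V ≤ n →
    ∀ (d : g →ₗ[F] V), (∀ x y : g, d ⁅x, y⁆ = ⁅x, d y⁆ - ⁅y, d x⁆) →
    ∃ v : V, ∀ x : g, d x = ⁅x, v⁆ := by
  induction n with
  | zero =>
    intro V _ _ _ _ _ hn d hd
    have : Subsingleton V := Module.finrank_zero_iff.1 (Nat.le_zero.1 hn)
    exact ⟨0, fun x => Subsingleton.elim _ _⟩
  | succ n ih =>
    intro V _ _ _ _ _ hn d hd
    rcases subsingleton_or_nontrivial V with hV | hV
    · exact ⟨0, fun x => Subsingleton.elim _ _⟩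
    by_cases hirr : ∀ N : LieSubmodule F g V, N = ⊥ ∨ N = ⊤
    · exact wh_irr hirr d hd
    push Not at hirr
    obtain ⟨W, hW0, hW1⟩ := hirr
    have hW0' : W.toSubmodule ≠ ⊥ := by simpa using hW0
    have hW1' : W.toSubmodule ≠ ⊤ := by simpa using hW1
    have hlt : Module.finrank F W < Module.finrank F V :=
      Submodule.finrank_lt (lt_top_iff_ne_top.2 hW1').ne
    have hpos : 0 < Module.finrank F W := by
      rw [Nat.pos_iff_ne_zero]
      intro h
      exact hW0' (Submodule.finrank_eq_zero.1 h)
    have hq : Module.finrank F (V ⧸ W) + Module.finrank F W = Module.finrank F V :=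
      Submodule.finrank_quotient_add_finrank W.toSubmodule
    obtain ⟨v', hv'⟩ := ih (V ⧸ W) (by omega)
      ((LieSubmodule.Quotient.mk' W : V →ₗ⁅F, g⁆ V ⧸ W).toLinearMap ∘ₗ d) (by
        intro x y
        simp only [LinearMap.comp_apply, hd, map_sub]
        rfl)
    obtain ⟨v, rfl⟩ := LieSubmodule.Quotient.surjective_mk' W v'
    have hmem : ∀ x : g, d x - ⁅x, v⁆ ∈ W := by
      intro x
      have := hv' x
      rw [← LieModuleHom.map_lie] at this
      have h2 : LieSubmodule.Quotient.mk' W (d x - ⁅x, v⁆) = 0 := by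
        rw [map_sub, sub_eq_zero]; exact this
      rwa [LieSubmodule.Quotient.mk'_apply, LieSubmodule.Quotient.mk_eq_zero'] at h2
    let d' : g →ₗ[F] W := LinearMap.codRestrict W.toSubmodule
      (d - (toEnd F g V : g →ₗ[F] Module.End F V).flip v) hmem
    have hd' : ∀ x, ((d' x : W) : V) = d x - ⁅x, v⁆ := fun x => rfl
    obtain ⟨w, hw⟩ := ih W (by omega) d' (by
      intro x y
      apply Subtype.ext
      rw [hd']
      simp only [LieSubmodule.coe_sub, LieSubmodule.coe_bracket, hd', hd, lie_sub, lie_lie]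
      abel)
    refine ⟨v + w, fun x => ?_⟩
    have := congrArg (Subtype.val) (hw x)
    rw [hd'] at this
    rw [lie_add, ← LieSubmodule.coe_bracket, ← this]
    abel

theorem weyl_proj (N : LieSubmodule F g V) :
    ∃ p : V →ₗ[F] V, (∀ v, p v ∈ N) ∧ (∀ v ∈ N, p v = v) ∧ ∀ (x : g) v, p ⁅x, v⁆ = ⁅x, p v⁆ := by
  obtain ⟨p0, hp0⟩ := N.toSubmodule.exists_isCompl
  let p : V →ₗ[F] V := N.toSubmodule.subtype ∘ₗ N.toSubmodule.projectionOnto p0 hp0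
  have hp1 : ∀ v, p v ∈ N := fun v => (N.toSubmodule.projectionOnto p0 hp0 v).2
  have hp2 : ∀ v ∈ N, p v = v := fun v hv =>
    congrArg Subtype.val (Submodule.projectionOnto_apply_left hp0 ⟨v, hv⟩)
  let H : LieSubmodule F g (V →ₗ[F] V) :=
    { carrier := {f | (∀ v, f v ∈ N) ∧ ∀ v ∈ N, f v = 0}
      add_mem' := by
        rintro f h ⟨a1, a2⟩ ⟨b1, b2⟩
        exact ⟨fun v => N.add_mem (a1 v) (b1 v), fun v hv => by simp [a2 v hv, b2 v hv]⟩
      zero_mem' := ⟨fun v => N.zero_mem, fun v _ => rfl⟩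
      smul_mem' := by
        rintro c f ⟨a1, a2⟩
        exact ⟨fun v => N.smul_mem c (a1 v), fun v hv => by simp [a2 v hv]⟩
      lie_mem := by
        rintro x f ⟨a1, a2⟩
        refine ⟨fun v => ?_, fun v hv => ?_⟩
        · rw [LieHom.lie_apply]
          exact N.sub_mem (N.lie_mem (a1 v)) (a1 _)
        · rw [LieHom.lie_apply, a2 v hv, a2 _ (N.lie_mem hv)]
          simp }
  have hmem : ∀ x : g, ⁅x, p⁆ ∈ H := by
    intro x
    refine ⟨fun v => ?_, fun v hv => ?_⟩
    · rw [LieHom.lie_apply]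
      exact N.sub_mem (N.lie_mem (hp1 v)) (hp1 _)
    · rw [LieHom.lie_apply, hp2 v hv, hp2 _ (N.lie_mem hv), sub_self]
  let d : g →ₗ[F] H := LinearMap.codRestrict H.toSubmodule
    ((toEnd F g (V →ₗ[F] V) : g →ₗ[F] Module.End F (V →ₗ[F] V)).flip p) hmem
  have hd : ∀ x, ((d x : H) : V →ₗ[F] V) = ⁅x, p⁆ := fun x => rfl
  obtain ⟨h, hh⟩ := wh_one_aux F g _ H le_rfl d (by
    intro x y
    apply Subtype.ext
    rw [hd]
    simp only [LieSubmodule.coe_sub, LieSubmodule.coe_bracket, hd, lie_lie])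
  obtain ⟨h, h1, h2⟩ := h
  refine ⟨p - h, fun v => N.sub_mem (hp1 v) (h1 v), fun v hv => ?_, fun x v => ?_⟩
  · rw [LinearMap.sub_apply, hp2 v hv, h2 v hv, sub_zero]
  · have h3 : ⁅x, p⁆ = ⁅x, h⁆ := congrArg Subtype.val (hh x)
    have h4 := LinearMap.congr_fun h3 v
    rw [LieHom.lie_apply, LieHom.lie_apply] at h4
    rw [LinearMap.sub_apply, LinearMap.sub_apply, lie_sub]
    rw [sub_eq_sub_iff_add_eq_add] at h4 ⊢
    rw [add_comm, ← h4, add_comm]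

theorem sst_isKilling (F : Type*) (g : Type*) [Field F] [CharZero F] [LieRing g] [LieAlgebra F g]
    [FiniteDimensional F g] (h : IsSemisimpleLieDef F g) : IsKilling F g := by
  have : HasTrivialRadical F g := by
    rw [hasTrivialRadical_iff_no_abelian_ideals]
    intro I hI
    have hI' : ∀ x ∈ I, ∀ y ∈ I, ⁅x, y⁆ = 0 := by
      rw [LieSubmodule.lie_abelian_iff_lie_self_eq_bot, LieSubmodule.lie_eq_bot_iff] at hI
      exact hI
    have := h I.toSubmodule (fun x a ha => ⟨lie_mem_right F g I x a ha, lie_mem_left F g I a x ha⟩)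
      ⟨1, by
        rw [derSeries, Submodule.span_eq_bot]
        rintro z ⟨a, ha, b, hb, rfl⟩
        exact hI' a ha b hb⟩
    simpa using this
  infer_instance

theorem sst_der_le (F : Type*) [Field F] {A : Type*} {B : Type*} [AddCommGroup A] [Module F A]
    [AddCommGroup B] [Module F B] (mA : A → A → A) (mB : B → B → B) (f : A →ₗ[F] B)
    (hf : ∀ x y, f (mA x y) = mB (f x) (f y)) (I : Submodule F A) (J : Submodule F B)
    (h : I ≤ J.comap f) (n : ℕ) : derSeries F mA I n ≤ (derSeries F mB J n).comap f := by
  induction n with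
  | zero => exact h
  | succ n ih =>
    rw [derSeries, Submodule.span_le]
    rintro z ⟨a, ha, b, hb, rfl⟩
    change f (mA a b) ∈ derSeries F mB J (n + 1)
    rw [hf]
    exact Submodule.subset_span ⟨f a, ih ha, f b, ih hb, rfl⟩

theorem sst_le_der (F : Type*) [Field F] {A : Type*} {B : Type*} [AddCommGroup A] [Module F A]
    [AddCommGroup B] [Module F B] (mA : A → A → A) (mB : B → B → B) (f : A →ₗ[F] B)
    (hf : ∀ x y, f (mA x y) = mB (f x) (f y)) (I : Submodule F A) (n : ℕ) :
    derSeries F mB (I.map f) n ≤ (derSeries F mA I n).map f := by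
  induction n with
  | zero => exact le_rfl
  | succ n ih =>
    rw [derSeries, Submodule.span_le]
    rintro z ⟨a, ha, b, hb, rfl⟩
    obtain ⟨a', ha', rfl⟩ := ih ha
    obtain ⟨b', hb', rfl⟩ := ih hb
    exact ⟨mA a' b', Submodule.subset_span ⟨a', ha', b', hb', rfl⟩, hf _ _⟩

theorem sst_backward (F : Type v) [Field F]
    (L : Type u) [AddCommGroup L] [Module F L] (mul : L → L → L)
    (g : Type u) [LieRing g] [LieAlgebra F g]
    (M : Type u) [AddCommGroup M] [Module F M] [LieRingModule g M] [LieModule F g M]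
    (hg : FiniteDimensional F g) (hgs : IsSemisimpleLieDef F g)
    (hM : FiniteDimensional F M) (hcr : IsCompletelyReducibleLieModule F g M)
    (hnt : HasNoTrivialLieSubmodule F g M)
    (e : L ≃ₗ[F] g × M) (he : ∀ x y : L, e (mul x y) = hemiMul (e x) (e y)) :
    FiniteDimensional F L ∧ IsSemisimpleLeibniz F mul := by
  refine ⟨Module.Finite.equiv e.symm, ?_⟩
  intro I hI hIs
  let f : L →ₗ[F] g := LinearMap.fst F g M ∘ₗ e.toLinearMap
  have hf : ∀ x y, f (mul x y) = ⁅f x, f y⁆ := by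
    intro x y
    change (e (mul x y)).1 = _
    rw [he]; rfl
  have hfs : ∀ y, ∃ x, f x = y := fun y => ⟨e.symm (y, 0), by simp [f]⟩
  have hJ : I.map f = ⊥ := by
    apply hgs
    · rintro x _ ⟨a, ha, rfl⟩
      obtain ⟨x, rfl⟩ := hfs x
      exact ⟨⟨mul x a, (hI x a ha).1, hf _ _⟩, ⟨mul a x, (hI x a ha).2, hf _ _⟩⟩
    · obtain ⟨n, hn⟩ := hIs
      refine ⟨n, ?_⟩
      have := sst_le_der F mul (fun x y : g => ⁅x, y⁆) f hf I n
      rw [hn, Submodule.map_bot] at this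
      exact le_bot_iff.1 this
  have hP : gModSpan F g M = ⊤ := by
    have hsub : ∀ (x : g) (n : M), ⁅x, n⁆ ∈ gModSpan F g M :=
      fun x n => Submodule.subset_span ⟨x, n, rfl⟩
    obtain ⟨N, hN, h1, h2⟩ := hcr (gModSpan F g M) (fun x n _ => hsub x n)
    have : N = ⊥ := hnt N hN (fun x n hn => by
      have : ⁅x, n⁆ ∈ gModSpan F g M ⊓ N := ⟨hsub x n, hN x n hn⟩
      rw [h1] at this
      simpa using this)
    rwa [this, sup_bot_eq] at h2
  have hm : ∀ m : M, e.symm (0, m) ∈ leibKer F mul := by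
    intro m
    have hmm : m ∈ gModSpan F g M := by rw [hP]; trivial
    have : gModSpan F g M ≤ (leibKer F mul).comap (e.symm.toLinearMap ∘ₗ LinearMap.inr F g M) := by
      rw [gModSpan, Submodule.span_le]
      rintro _ ⟨x, n, rfl⟩
      refine Submodule.subset_span ⟨e.symm (x, n), ?_⟩
      apply e.injective
      rw [he]
      simp [hemiMul]
    exact this hmm
  intro a ha
  have h0 : f a ∈ I.map f := ⟨a, ha, rfl⟩
  rw [hJ] at h0
  have h0' : (e a).1 = 0 := (Submodule.mem_bot F).1 h0
  have : a = e.symm (0, (e a).2) := by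
    rw [← h0']; simp
  rw [this]
  exact hm _

theorem sst_cr (F : Type*) (g : Type*) [Field F] [CharZero F] [LieRing g] [LieAlgebra F g]
    [FiniteDimensional F g] [IsKilling F g] (V : Type*) [AddCommGroup V] [Module F V]
    [LieRingModule g V] [LieModule F g V] [FiniteDimensional F V] :
    IsCompletelyReducibleLieModule F g V := by
  intro N hN
  obtain ⟨p, h1, h2, h3⟩ := weyl_proj (F := F) (g := g) (V := V)
    { N with lie_mem := fun {x m} hm => hN x m hm }
  refine ⟨LinearMap.ker p, ?_, ?_, ?_⟩
  · intro x n hn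
    rw [LinearMap.mem_ker] at hn ⊢
    rw [h3, hn, lie_zero]
  · rw [eq_bot_iff]
    rintro n ⟨hn, hn'⟩
    rw [Submodule.mem_bot, ← h2 n hn]
    exact hn'
  · rw [eq_top_iff]
    rintro v -
    refine Submodule.mem_sup.2 ⟨p v, h1 v, v - p v, ?_, by abel⟩
    rw [LinearMap.mem_ker, map_sub, h2 _ (h1 v), sub_self]

theorem sst_forward (F : Type v) [Field F] [CharZero F]
    (L : Type u) [AddCommGroup L] [Module F L] (mul : L → L → L)
    (hbil : IsBilinearMul F mul) (hleib : IsLeftLeibnizMul mul)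
    (hfd : FiniteDimensional F L) (hss : IsSemisimpleLeibniz F mul) :
      ∃ (g : Type u) (_ : LieRing g) (_ : LieAlgebra F g)
        (M : Type u) (_ : AddCommGroup M) (_ : Module F M)
        (_ : LieRingModule g M) (_ : LieModule F g M),
        FiniteDimensional F g ∧ IsSemisimpleLieDef F g ∧
        FiniteDimensional F M ∧ IsCompletelyReducibleLieModule F g M ∧
        HasNoTrivialLieSubmodule F g M ∧
        ∃ e : L ≃ₗ[F] g × M, ∀ x y : L, e (mul x y) = hemiMul (e x) (e y) := by
  obtain ⟨b1, b2, b3, b4⟩ := hbil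
  let lam : L →ₗ[F] Module.End F L := LinearMap.mk₂ F mul b1 b3 b2 b4
  have hlam : ∀ x y, lam x y = mul x y := fun x y => rfl
  have hlie : ∀ x y, lam (mul x y) = ⁅lam x, lam y⁆ := by
    intro x y
    ext z
    rw [Ring.lie_def]
    change mul (mul x y) z = mul x (mul y z) - mul y (mul x z)
    rw [hleib x y z]; abel
  let g : LieSubalgebra F (Module.End F L) :=
    { LinearMap.range lam with
      lie_mem' := by
        rintro _ _ ⟨x, rfl⟩ ⟨y, rfl⟩
        exact ⟨mul x y, hlie x y⟩ }
  let r : L →ₗ[F] g := lam.codRestrict g.toSubmodule (fun x => ⟨x, rfl⟩)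
  have hrs : ∀ y : g, ∃ x, r x = y := by
    rintro ⟨_, x, rfl⟩
    exact ⟨x, rfl⟩
  have hr : ∀ x y, r (mul x y) = ⁅r x, r y⁆ := fun x y => Subtype.ext (hlie x y)
  have hact : ∀ x y, ⁅r x, y⁆ = mul x y := fun x y => rfl
  have h0r : ∀ x, mul 0 x = 0 := fun x => by rw [← hlam, map_zero]; rfl
  have hr0 : ∀ x, mul x 0 = 0 := fun x => by rw [← hlam, map_zero]
  have hle1 : leibKer F mul ≤ LinearMap.ker r := by
    rw [leibKer, Submodule.span_le]
    rintro _ ⟨x, rfl⟩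
    change r (mul x x) = 0
    rw [hr, lie_self]
  have hkerm : ∀ x ∈ LinearMap.ker r, ∀ y, mul x y = 0 := by
    intro x hx y
    rw [← hact, LinearMap.mem_ker.1 hx]; simp
  have hcom : ∀ J : Submodule F g, IsIdealOf F (fun x y : g => ⁅x, y⁆) J →
      IsSolvableSub F (fun x y : g => ⁅x, y⁆) J → J.comap r ≤ leibKer F mul := by
    rintro J hJ ⟨n, hn⟩
    apply hss
    · intro x a ha
      simp only [Submodule.mem_comap] at ha ⊢
      rw [hr, hr]
      exact hJ _ _ ha
    · refine ⟨n + 1, ?_⟩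
      have hd := sst_der_le F mul (fun x y : g => ⁅x, y⁆) r hr (J.comap r) J le_rfl n
      rw [hn] at hd
      rw [derSeries, Submodule.span_eq_bot]
      rintro z ⟨a, ha, b, hb, rfl⟩
      exact hkerm a (hd ha) b
  have hker : ∀ x, r x = 0 → x ∈ leibKer F mul := by
    intro x hx
    refine hcom ⊥ ?_ ⟨0, rfl⟩ ?_
    · intro x a ha
      rw [Submodule.mem_bot] at ha
      subst ha
      simp
    · simpa using hx
  have hgs : IsSemisimpleLieDef F g := by
    intro J hJ hJs
    rw [eq_bot_iff]
    intro y hy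
    obtain ⟨x, rfl⟩ := hrs y
    exact hle1 (hcom J hJ hJs hy)
  have hgfd : FiniteDimensional F g := Module.Finite.of_surjective r hrs
  have hK : IsKilling F g := sst_isKilling F g hgs
  let N : LieSubmodule F g L :=
    { leibKer F mul with
      lie_mem := by
        intro x m hm
        obtain ⟨x, rfl⟩ := hrs x
        apply hker
        rw [hact, hr, show r m = 0 from hle1 hm, lie_zero] }
  obtain ⟨p, hp1, hp2, hp3⟩ := weyl_proj (F := F) (g := g) (V := L) N
  have hpm : ∀ x y, p (mul x y) = mul x (p y) := fun x y => hp3 (r x) y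
  have hkN : ∀ x, r x = 0 → x ∈ N := hker
  have hNk : ∀ x ∈ N, r x = 0 := fun x hx => hle1 hx
  let e0 : L →ₗ[F] g × N := r.prod (p.codRestrict N.toSubmodule hp1)
  have he0 : ∀ x, e0 x = (r x, ⟨p x, hp1 x⟩) := fun x => rfl
  have hinj : Function.Injective e0 := by
    rw [injective_iff_map_eq_zero]
    intro x hx
    rw [he0, Prod.mk_eq_zero] at hx
    have h1 := hkN x hx.1
    have h2 : p x = 0 := congrArg Subtype.val hx.2
    rw [← hp2 x h1, h2]
  have hsurj : Function.Surjective e0 := by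
    rintro ⟨y, m, hm⟩
    obtain ⟨y, rfl⟩ := hrs y
    refine ⟨y - p y + m, ?_⟩
    rw [he0]
    ext1
    · change r (y - p y + m) = r y
      rw [map_add, map_sub, hNk _ (hp1 y), hNk m hm]; simp
    · apply Subtype.ext
      change p (y - p y + m) = m
      rw [map_add, map_sub, hp2 _ (hp1 y), hp2 m hm]; simp
  refine ⟨g, inferInstance, inferInstance, N, inferInstance, inferInstance, inferInstance,
    inferInstance, hgfd, hgs, inferInstanceAs (FiniteDimensional F N.toSubmodule),
    @sst_cr F g _ _ _ _ hgfd hK N _ _ _ _ (inferInstanceAs (FiniteDimensional F N.toSubmodule)),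
    ?_, LinearEquiv.ofBijective e0 ⟨hinj, hsurj⟩, ?_⟩
  · intro N0 hN0 htr
    let N1 : LieSubmodule F g L :=
      { N0.map N.toSubmodule.subtype with
        lie_mem := by
          rintro x _ ⟨m, hm, rfl⟩
          exact ⟨(⁅x, (show N from m)⁆ : N), hN0 x m hm, rfl⟩ }
    obtain ⟨q, hq1, hq2, hq3⟩ := weyl_proj (F := F) (g := g) (V := L) N1
    have hq0 : leibKer F mul ≤ LinearMap.ker q := by
      rw [leibKer, Submodule.span_le]
      rintro _ ⟨x, rfl⟩
      change q (mul x x) = 0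
      have hxx : mul x x ∈ N := Submodule.subset_span ⟨x, rfl⟩
      rw [← hp2 _ hxx, hpm, ← hact, hq3]
      obtain ⟨m, hm, hm'⟩ := hq1 (p x)
      rw [← hm']
      exact congrArg Subtype.val (htr (r x) m hm)
    rw [eq_bot_iff]
    intro m hm
    have h1 : (m : L) ∈ N1 := ⟨m, hm, rfl⟩
    have h2 : q (m : L) = 0 := hq0 m.2
    rw [hq2 _ h1] at h2
    rw [Submodule.mem_bot]
    exact Subtype.ext h2
  · intro x y
    change e0 (mul x y) = hemiMul (e0 x) (e0 y)
    rw [he0, he0, he0, hemiMul]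
    ext1
    · exact hr x y
    · exact Subtype.ext (hpm x y)

end WeylHelpers

/-- In characteristic zero, a left Leibniz algebra `L` is
finite-dimensional semi-simple if, and only if, it is isomorphic to the left
hemi-semidirect product of a finite-dimensional semi-simple Lie algebra `g` and a
finite-dimensional completely reducible left `g`-module `M` containing no non-zero
trivial `g`-submodule. -/
theorem semisimple_structure_theorem (F : Type v) [Field F] [CharZero F]
    (L : Type u) [AddCommGroup L] [Module F L] (mul : L → L → L)
    (hbil : IsBilinearMul F mul) (hleib : IsLeftLeibnizMul mul) :
    (FiniteDimensional F L ∧ IsSemisimpleLeibniz F mul) ↔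
      ∃ (g : Type u) (_ : LieRing g) (_ : LieAlgebra F g)
        (M : Type u) (_ : AddCommGroup M) (_ : Module F M)
        (_ : LieRingModule g M) (_ : LieModule F g M),
        FiniteDimensional F g ∧ IsSemisimpleLieDef F g ∧
        FiniteDimensional F M ∧ IsCompletelyReducibleLieModule F g M ∧
        HasNoTrivialLieSubmodule F g M ∧
        ∃ e : L ≃ₗ[F] g × M, ∀ x y : L, e (mul x y) = hemiMul (e x) (e y) := by
  constructor
  · rintro ⟨hfd, hss⟩
    exact sst_forward F L mul hbil hleib hfd hss
  · rintro ⟨g, _, _, M, _, _, _, _, hg, hgs, hM, hcr, hnt, e, he⟩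
    exact sst_backward F L mul g M hg hgs hM hcr hnt e he
end

section
/- Let F be a field of characteristic zero and let L be a left Leibniz algebra over F. Then L is finite-dimensional and simple if, and only if, either L is a finite-dimensional simple Lie algebra (i.e., xx = 0 for all x ∈ L and L is simple as a Lie algebra), or there exist a finite-dimensional simple Lie algebra g over F and a non-trivial finite-dimensional irreducible left g-module M such that L is isomorphic to the left hemi-semidirect product g ⋉_ℓ M (i.e., there is an F-linear bijection L → g × M carrying the multiplication of L to the multiplication of g ⋉_ℓ M). -/
universe u v w

namespace LeibAux

open LieModule Module

section Whitehead

variable {F : Type v} [Field F] {g : Type u} [LieRing g] [LieAlgebra F g]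

lemma derived_top (hs : LieAlgebra.IsSimple F g) : LieAlgebra.derivedSeries F g 1 = ⊤ := by
  rcases hs.eq_bot_or_eq_top (LieAlgebra.derivedSeries F g 1) with h | h
  · exfalso
    apply hs.non_abelian
    refine ⟨fun x y => ?_⟩
    have : ⁅x, y⁆ ∈ LieAlgebra.derivedSeries F g 1 := by
      have h2 := LieAlgebra.coe_derivedSeries_one_eq (R := F) (L := g)
      have h3 : ⁅x, y⁆ ∈ Submodule.span F {z : g | ∃ x y : g, ⁅x, y⁆ = z} :=
        Submodule.subset_span ⟨x, y, rfl⟩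
      rw [← h2] at h3
      exact h3
    rw [h] at this
    simpa using this
  · exact h

lemma span_top (hs : LieAlgebra.IsSimple F g) :
    Submodule.span F {z : g | ∃ x y : g, ⁅x, y⁆ = z} = ⊤ := by
  have := LieAlgebra.coe_derivedSeries_one_eq (R := F) (L := g)
  rw [derived_top hs] at this
  rw [← this]
  rfl

variable {V : Type w} [AddCommGroup V] [Module F V] [LieRingModule g V] [LieModule F g V]

lemma sum_inv {ι : Type*} [Fintype ι] [DecidableEq ι] (B : LinearMap.BilinForm F g)
    (hB : B.Nondegenerate) (hsymm : B.IsSymm) (hinv : B.lieInvariant g) (b : Basis ι F g)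
    (f : g →ₗ[F] g →ₗ[F] V) (x : g) :
    ∑ i, f ⁅x, b i⁆ (B.dualBasis hB b i) = - ∑ i, f (b i) ⁅x, B.dualBasis hB b i⁆ := by
  set b' := B.dualBasis hB b with hb'
  have h1 : ∀ y, y = ∑ j, B y (b j) • b' j := fun y => by
    conv_lhs => rw [← b'.sum_repr y]
    simp only [hb', LinearMap.BilinForm.dualBasis_repr_apply]
  have h2 : ∀ y, y = ∑ j, B y (b' j) • b j := fun y => by
    have hbb : B.dualBasis hB b' = b := LinearMap.BilinForm.dualBasis_dualBasis hB hsymm b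
    conv_lhs => rw [← b.sum_repr y]
    refine Finset.sum_congr rfl fun j _ => ?_
    rw [← LinearMap.BilinForm.dualBasis_repr_apply hB b', hbb]
  calc ∑ i, f ⁅x, b i⁆ (b' i) = ∑ i, ∑ j, B ⁅x, b i⁆ (b' j) • f (b j) (b' i) := by
        refine Finset.sum_congr rfl fun i _ => ?_
        conv_lhs => rw [h2 ⁅x, b i⁆]
        simp
    _ = ∑ j, ∑ i, B ⁅x, b i⁆ (b' j) • f (b j) (b' i) := Finset.sum_comm
    _ = _ := by
        rw [← Finset.sum_neg_distrib]
        refine Finset.sum_congr rfl fun j _ => ?_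
        conv_rhs => rw [h1 ⁅x, b' j⁆]
        rw [map_sum, ← Finset.sum_neg_distrib]
        refine Finset.sum_congr rfl fun i _ => ?_
        rw [hinv, hsymm.eq (b i)]
        simp

lemma casimir_cocycle {ι : Type*} [Fintype ι] [DecidableEq ι] (B : LinearMap.BilinForm F g)
    (hB : B.Nondegenerate) (hsymm : B.IsSymm) (hinv : B.lieInvariant g) (b : Basis ι F g)
    (d : g →ₗ[F] V) (hd : ∀ x y, d ⁅x, y⁆ = ⁅x, d y⁆ - ⁅y, d x⁆) (x : g) :
    ⁅x, ∑ i, ⁅b i, d (B.dualBasis hB b i)⁆⁆ = ∑ i, ⁅b i, ⁅B.dualBasis hB b i, d x⁆⁆ := by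
  have := sum_inv B hB hsymm hinv b ((toEnd F g V : g →ₗ[F] V →ₗ[F] V).compl₂ d) x
  simp only [LinearMap.compl₂_apply, LieHom.coe_toLinearMap, toEnd_apply_apply, hd] at this
  rw [lie_sum]
  simp_rw [leibniz_lie x (b _)]
  rw [Finset.sum_add_distrib, this]
  simp [Finset.sum_sub_distrib]

lemma nondeg [CharZero F] [FiniteDimensional F g] (hs : LieAlgebra.IsSimple F g)
    [FiniteDimensional F V] [Nontrivial V]
    (hirr : ∀ N : LieSubmodule F g V, N = ⊥ ∨ N = ⊤) (hnt : ∃ (x : g) (m : V), ⁅x, m⁆ ≠ 0) :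
    (traceForm F g V).Nondegenerate := by
  have hinv := traceForm_lieInvariant F g V
  rcases hs.eq_bot_or_eq_top (LieAlgebra.InvariantForm.orthogonal _ hinv ⊤) with h | h
  · have hk : LinearMap.ker (traceForm F g V) = ⊥ := by
      rw [LinearMap.ker_eq_bot']
      intro m hm
      have : m ∈ LieAlgebra.InvariantForm.orthogonal _ hinv ⊤ := by
        rw [LieAlgebra.InvariantForm.mem_orthogonal]
        intro x _
        rw [traceForm_comm, hm]; rfl
      rw [h] at this
      simpa using this
    exact (LinearMap.BilinForm.nondegenerate_iff_ker_eq_bot).mpr hk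
  · exfalso
    have h0 : traceForm F g V = 0 := by
      ext x y
      have : y ∈ LieAlgebra.InvariantForm.orthogonal _ hinv ⊤ := by rw [h]; trivial
      rw [LieAlgebra.InvariantForm.mem_orthogonal] at this
      exact this x trivial
    have hn := isNilpotent_derivedSeries_of_traceForm_eq_zero h0
    rw [isNilpotent_iff_forall' (R := F)] at hn
    have hnil : IsNilpotent g V := by
      rw [isNilpotent_iff_forall' (R := F)]
      intro x
      exact hn ⟨x, by rw [derived_top hs]; trivial⟩
    have := nontrivial_max_triv_of_isNilpotent F g V
    rcases hirr (maxTrivSubmodule F g V) with h | h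
    · rw [h] at this
      exact not_nontrivial _ this
    · obtain ⟨x, m, hm⟩ := hnt
      have : m ∈ maxTrivSubmodule F g V := by rw [h]; trivial
      exact hm (this x)

lemma whitehead_irr [CharZero F] [FiniteDimensional F g] (hs : LieAlgebra.IsSimple F g)
    [FiniteDimensional F V] [Nontrivial V]
    (hirr : ∀ N : LieSubmodule F g V, N = ⊥ ∨ N = ⊤)
    (d : g →ₗ[F] V) (hd : ∀ x y, d ⁅x, y⁆ = ⁅x, d y⁆ - ⁅y, d x⁆) :
    ∃ v : V, ∀ x, d x = ⁅x, v⁆ := by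
  by_cases hnt : ∃ (x : g) (m : V), ⁅x, m⁆ ≠ 0
  · have hB := nondeg hs hirr hnt
    have hinv := traceForm_lieInvariant F g V
    have hsymm : (traceForm F g V).IsSymm := ⟨traceForm_comm F g V⟩
    set B := traceForm F g V with hBdef
    let b := Module.finBasis F g
    let b' := B.dualBasis hB b
    let φ := toEnd F g V
    let C : V →ₗ[F] V := ∑ i, φ (b i) ∘ₗ φ (b' i)
    have hC : ∀ v, C v = ∑ i, ⁅b i, ⁅b' i, v⁆⁆ := fun v => by
      simp [C, φ, LinearMap.sum_apply]
    have hcomm : ∀ x v, ⁅x, C v⁆ = C ⁅x, v⁆ := fun x v => by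
      let d' : g →ₗ[F] V := (toEnd F g V : g →ₗ[F] V →ₗ[F] V).flip v
      have := casimir_cocycle B hB hsymm hinv b d' (fun x y => by simp [d']) x
      rw [hC, hC]
      exact this
    have htr : LinearMap.trace F V C = (finrank F g : F) := by
      simp only [C, map_sum]
      have : ∀ i, LinearMap.trace F V (φ (b i) ∘ₗ φ (b' i)) = 1 := fun i => by
        have h1 := LinearMap.BilinForm.apply_dualBasis_right (B := B) hB hsymm b i i
        rw [if_pos rfl] at h1
        exact h1
      simp [this]
    have hfr : 0 < finrank F g := by
      obtain ⟨x, m, hm⟩ := hnt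
      have : Nontrivial g := ⟨x, 0, fun h => hm (by simp [h])⟩
      exact finrank_pos
    let K : LieSubmodule F g V :=
      { LinearMap.ker C with
        lie_mem := fun {x m} hm => by
          change C ⁅x, m⁆ = 0
          have hm' : C m = 0 := hm
          rw [← hcomm, hm', lie_zero] }
    have hinj : LinearMap.ker C = ⊥ := by
      rcases hirr K with h | h
      · exact congrArg LieSubmodule.toSubmodule h
      · exfalso
        have h1 : LinearMap.ker C = ⊤ := congrArg LieSubmodule.toSubmodule h
        rw [LinearMap.ker_eq_top] at h1
        rw [h1, map_zero] at htr
        exact hfr.ne' (by exact_mod_cast htr.symm)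
    have hinj' := LinearMap.ker_eq_bot.mp hinj
    obtain ⟨u, hu⟩ := (LinearMap.injective_iff_surjective.mp hinj') (∑ i, ⁅b i, d (b' i)⁆)
    refine ⟨u, fun x => hinj' ?_⟩
    rw [← hcomm, hu, hC]
    exact (casimir_cocycle B hB hsymm hinv b d hd x).symm
  · push Not at hnt
    refine ⟨0, fun x => ?_⟩
    have hx : x ∈ Submodule.span F {z : g | ∃ x y : g, ⁅x, y⁆ = z} := by
      rw [span_top hs]; trivial
    have : Submodule.span F {z : g | ∃ x y : g, ⁅x, y⁆ = z} ≤ LinearMap.ker d := by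
      rw [Submodule.span_le]
      rintro _ ⟨y, z, rfl⟩
      change d _ = 0
      simp [hd, hnt]
    rw [lie_zero]
    exact this hx

end Whitehead

theorem whitehead {F : Type v} [Field F] {g : Type u} [LieRing g] [LieAlgebra F g]
    [CharZero F] [FiniteDimensional F g] (hs : LieAlgebra.IsSimple F g) (n : ℕ) :
    ∀ (V : Type w) [AddCommGroup V] [Module F V] [LieRingModule g V] [LieModule F g V]
    [FiniteDimensional F V] (_ : finrank F V = n)
    (d : g →ₗ[F] V) (_ : ∀ x y, d ⁅x, y⁆ = ⁅x, d y⁆ - ⁅y, d x⁆),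
    ∃ v : V, ∀ x, d x = ⁅x, v⁆ := by
  induction n using Nat.strong_induction_on with
  | _ n ih =>
  intro V _ _ _ _ _ hn d hd
  by_cases hirr : ∀ N : LieSubmodule F g V, N = ⊥ ∨ N = ⊤
  · rcases subsingleton_or_nontrivial V with h | h
    · exact ⟨0, fun x => Subsingleton.elim _ _⟩
    · exact whitehead_irr hs hirr d hd
  · push Not at hirr
    obtain ⟨N, hN0, hN1⟩ := hirr
    have hN0' : N.toSubmodule ≠ ⊥ := fun h => hN0 (by simpa using h)
    have hN1' : N.toSubmodule ≠ ⊤ := fun h => hN1 (by simpa using h)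
    have hlt : finrank F N < n := by
      rw [← hn]; exact Submodule.finrank_lt hN1'
    have hlt2 : finrank F (V ⧸ N) < n := by
      have h1 := Submodule.finrank_quotient_add_finrank N.toSubmodule
      have h2 : finrank F N.toSubmodule ≠ 0 := fun h =>
        hN0' (Submodule.finrank_eq_zero.mp h)
      change finrank F (V ⧸ N.toSubmodule) < n
      omega
    obtain ⟨w, hw⟩ := ih _ hlt2 (V ⧸ N) rfl
      ((LieSubmodule.Quotient.mk' N : V →ₗ[F] V ⧸ N) ∘ₗ d) (fun x y => by
        change LieSubmodule.Quotient.mk' N (d ⁅x, y⁆) =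
          ⁅x, LieSubmodule.Quotient.mk' N (d y)⁆ - ⁅y, LieSubmodule.Quotient.mk' N (d x)⁆
        rw [hd, map_sub, LieModuleHom.map_lie, LieModuleHom.map_lie])
    obtain ⟨v, rfl⟩ := LieSubmodule.Quotient.surjective_mk' N w
    have hmem : ∀ x, d x - ⁅x, v⁆ ∈ N := fun x => by
      rw [← LieSubmodule.Quotient.mk_eq_zero']
      have := hw x
      change LieSubmodule.Quotient.mk' N (d x) = _ at this
      rw [← LieModuleHom.map_lie] at this
      change LieSubmodule.Quotient.mk' N (d x - ⁅x, v⁆) = 0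
      rw [map_sub, this, sub_self]
    let dv : g →ₗ[F] V := d - (toEnd F g V : g →ₗ[F] V →ₗ[F] V).flip v
    obtain ⟨u, hu⟩ := ih _ hlt N rfl (dv.codRestrict N.toSubmodule hmem) (fun x y => by
        apply Subtype.ext
        change d ⁅x, y⁆ - ⁅⁅x, y⁆, v⁆ = ⁅x, d y - ⁅y, v⁆⁆ - ⁅y, d x - ⁅x, v⁆⁆
        rw [hd, lie_lie, lie_sub, lie_sub]
        abel)
    refine ⟨v + u, fun x => ?_⟩
    have : d x - ⁅x, v⁆ = ⁅x, (u : V)⁆ := congrArg Subtype.val (hu x)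
    rw [lie_add, ← this]
    abel

section Split

variable {F : Type v} [Field F] {g : Type u} [LieRing g] [LieAlgebra F g]
  {E : Type u} [AddCommGroup E] [Module F E] [LieRingModule g E] [LieModule F g E]

lemma split [CharZero F] [FiniteDimensional F g] (hs : LieAlgebra.IsSimple F g)
    [FiniteDimensional F E] (p : E →ₗ⁅F,g⁆ g) (hp : Function.Surjective p) :
    ∃ σ : g →ₗ[F] E, (∀ x, p (σ x) = x) ∧ ∀ x y : g, σ ⁅x, y⁆ = ⁅x, σ y⁆ := by
  obtain ⟨s, hs'⟩ := LinearMap.exists_rightInverse_of_surjective (p : E →ₗ[F] g)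
    (LinearMap.range_eq_top.mpr hp)
  have hps : ∀ x, p (s x) = x := fun x => LinearMap.congr_fun hs' x
  let D : g →ₗ[F] g →ₗ[F] p.ker := LinearMap.mk₂ F
    (fun x y => ⟨⁅x, s y⁆ - s ⁅x, y⁆, by
      rw [LieModuleHom.mem_ker, map_sub, LieModuleHom.map_lie, hps, hps, sub_self]⟩)
    (fun x y z => by apply Subtype.ext; simp; abel)
    (fun c x y => by apply Subtype.ext; simp [smul_sub])
    (fun x y z => by apply Subtype.ext; simp; abel)
    (fun c x y => by apply Subtype.ext; simp [smul_sub])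
  have hD : ∀ x y, ((D x y : p.ker) : E) = ⁅x, s y⁆ - s ⁅x, y⁆ := fun _ _ => rfl
  obtain ⟨f, hf⟩ := whitehead hs _ (g →ₗ[F] p.ker) rfl D (fun x y => by
    ext z
    simp only [LinearMap.sub_apply, LieHom.lie_apply, LieSubmodule.coe_sub,
      LieSubmodule.coe_bracket, hD, lie_sub, lie_lie, map_sub]
    abel)
  refine ⟨s - p.ker.toSubmodule.subtype ∘ₗ f, fun x => ?_, fun x y => ?_⟩
  · have : p (f x : E) = 0 := (f x).2
    rw [LinearMap.sub_apply, map_sub, hps]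
    change x - p (f x : E) = x
    rw [this, sub_zero]
  · have := congrArg Subtype.val (LinearMap.congr_fun (hf x) y)
    rw [hD, LieHom.lie_apply, LieSubmodule.coe_sub, LieSubmodule.coe_bracket] at this
    simp only [LinearMap.sub_apply, LinearMap.comp_apply, Submodule.subtype_apply, lie_sub]
    rw [sub_eq_sub_iff_add_eq_add] at this ⊢
    rw [add_comm, ← this]

end Split

section Reverse

lemma isSimpleLie_of_def {F : Type v} [Field F] {g : Type u} [LieRing g] [LieAlgebra F g]
    (h : IsSimpleLieDef F g) : LieAlgebra.IsSimple F g where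
  eq_bot_or_eq_top I := by
    have := h.2 I.toSubmodule (fun x a ha => ⟨I.lie_mem ha, by
      change ⁅a, x⁆ ∈ I
      rw [← lie_skew]
      exact neg_mem (I.lie_mem ha)⟩)
    simpa using this
  non_abelian hab := by
    obtain ⟨x, y, hxy⟩ := h.1
    exact hxy (hab.trivial x y)

variable {F : Type v} [Field F] {L : Type u} [AddCommGroup L] [Module F L] {mul : L → L → L}

lemma reverse_lie (h0 : ∀ x : L, mul x x = 0) (hs : IsSimpleMul F mul) :
    IsSimpleLeibniz F mul := by
  have hk : leibKer F mul = ⊥ := by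
    rw [leibKer, Submodule.span_eq_bot]
    rintro _ ⟨x, rfl⟩
    exact h0 x
  refine ⟨fun I hI => (hs.2 I hI).imp id Or.inr, ?_⟩
  rw [hk, bot_lt_iff_ne_bot]
  intro h
  obtain ⟨x, y, hxy⟩ := hs.1
  have : mul x y ∈ derivedSub F mul := Submodule.subset_span ⟨x, y, rfl⟩
  rw [h] at this
  exact hxy (by simpa using this)

lemma forward_lie (hk : leibKer F mul = ⊥) (hs : IsSimpleLeibniz F mul) :
    (∀ x : L, mul x x = 0) ∧ IsSimpleMul F mul := by
  refine ⟨fun x => ?_, ?_, fun I hI => ?_⟩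
  · have : mul x x ∈ leibKer F mul := Submodule.subset_span ⟨x, rfl⟩
    rw [hk] at this
    simpa using this
  · by_contra! h
    have := hs.2
    rw [hk, bot_lt_iff_ne_bot] at this
    apply this
    rw [derivedSub, Submodule.span_eq_bot]
    rintro _ ⟨x, y, rfl⟩
    exact h x y
  · have := hs.1 I hI
    rw [hk] at this
    tauto

lemma reverse_hemi {g M : Type u} [LieRing g] [LieAlgebra F g] [AddCommGroup M] [Module F M]
    [LieRingModule g M] [LieModule F g M] (hg : IsSimpleLieDef F g)
    (hnt : ∃ (x : g) (m : M), ⁅x, m⁆ ≠ 0) (hirr : IsIrreducibleLieModule F g M)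
    (e : L ≃ₗ[F] g × M) (he : ∀ x y : L, e (mul x y) = hemiMul (e x) (e y)) :
    IsSimpleLeibniz F mul := by
  have he1 : ∀ x y, (e (mul x y)).1 = ⁅(e x).1, (e y).1⁆ := fun x y => by rw [he]; rfl
  have he2 : ∀ x y, (e (mul x y)).2 = ⁅(e x).1, (e y).2⁆ := fun x y => by rw [he]; rfl
  have hsm : ∀ x y, mul x y = e.symm (⁅(e x).1, (e y).1⁆, ⁅(e x).1, (e y).2⁆) := fun x y => by
    rw [← he1, ← he2]; simp
  let j : M →ₗ[F] L := e.symm.toLinearMap ∘ₗ LinearMap.inr F g M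
  have hj : ∀ m, j m = e.symm (0, m) := fun _ => rfl
  -- a subspace containing all brackets contains the module part
  have key : ∀ I : Submodule F L, (∀ (x : g) (m : M), j ⁅x, m⁆ ∈ I) → ∀ m, j m ∈ I := by
    intro I hI m
    rcases hirr.2 (I.comap j) (fun x n _ => hI x n) with h | h
    · exfalso
      obtain ⟨x, m, hm⟩ := hnt
      have : ⁅x, m⁆ ∈ I.comap j := hI x m
      rw [h] at this
      exact hm (by simpa using this)
    · have : m ∈ I.comap j := by rw [h]; trivial
      exact this
  have hK : ∀ x, x ∈ leibKer F mul ↔ (e x).1 = 0 := by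
    intro x
    constructor
    · intro hx
      have : leibKer F mul ≤ LinearMap.ker (LinearMap.fst F g M ∘ₗ e.toLinearMap) := by
        rw [leibKer, Submodule.span_le]
        rintro _ ⟨y, rfl⟩
        change (e (mul y y)).1 = 0
        rw [he1, lie_self]
      exact this hx
    · intro hx
      have : x = j (e x).2 := by
        rw [hj, ← hx]; simp
      rw [this]
      refine key (leibKer F mul) (fun y m => ?_) _
      have h1 : j ⁅y, m⁆ = mul (e.symm (y, m)) (e.symm (y, m)) := by
        rw [hsm]; simp [hj]
      rw [h1]
      exact Submodule.subset_span ⟨_, rfl⟩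
  refine ⟨fun I hI => ?_, ?_⟩
  · rcases hg.2 (I.map (LinearMap.fst F g M ∘ₗ e.toLinearMap)) (by
      rintro x _ ⟨a, ha, rfl⟩
      constructor
      · refine ⟨mul (e.symm (x, 0)) a, (hI _ a ha).1, ?_⟩
        change (e _).1 = _
        rw [he1]; simp
      · refine ⟨mul a (e.symm (x, 0)), (hI _ a ha).2, ?_⟩
        change (e _).1 = _
        rw [he1]; simp) with h | h
    · have hI0 : ∀ a ∈ I, (e a).1 = 0 := fun a ha => by
        have : (e a).1 ∈ I.map (LinearMap.fst F g M ∘ₗ e.toLinearMap) := ⟨a, ha, rfl⟩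
        rw [h] at this
        simpa using this
      have hIj : ∀ a ∈ I, a = j (e a).2 := fun a ha => by
        rw [hj, ← hI0 a ha]; simp
      rcases hirr.2 (I.comap j) (fun x n hn => by
        have := (hI (e.symm (x, 0)) _ hn).1
        rw [hsm] at this
        simpa [hj] using this) with h' | h'
      · left
        rw [eq_bot_iff]
        intro a ha
        have h1 := hIj a ha
        have h2 : (e a).2 ∈ I.comap j := by
          change j _ ∈ I
          rw [← h1]; exact ha
        rw [h'] at h2
        rw [(Submodule.mem_bot F).mp h2, map_zero] at h1
        simpa using h1
      · right; left
        ext x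
        rw [hK]
        refine ⟨hI0 x, fun hx => ?_⟩
        have h1 : x = j (e x).2 := by rw [hj, ← hx]; simp
        have h2 : (e x).2 ∈ I.comap j := by rw [h']; trivial
        rw [h1]; exact h2
    · right; right
      have hsurj : ∀ x : g, ∃ a ∈ I, (e a).1 = x := fun x => by
        have : x ∈ I.map (LinearMap.fst F g M ∘ₗ e.toLinearMap) := by rw [h]; trivial
        exact this
      have hjI : ∀ m, j m ∈ I := key I (fun x m => by
        obtain ⟨a, ha, rfl⟩ := hsurj x
        have := (hI (e.symm (0, m)) a ha).2
        rw [hsm] at this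
        simpa [hj] using this)
      rw [eq_top_iff]
      intro y _
      obtain ⟨a, ha, hay⟩ := hsurj (e y).1
      have : y = a + j ((e y).2 - (e a).2) := by
        apply e.injective
        rw [map_add, hj]
        ext <;> simp [hay]
      rw [this]
      exact add_mem ha (hjI _)
  · refine lt_of_le_of_ne (Submodule.span_mono ?_) fun h => ?_
    · rintro _ ⟨x, rfl⟩
      exact ⟨x, x, rfl⟩
    · obtain ⟨x, y, hxy⟩ := hg.1
      have : mul (e.symm (x, 0)) (e.symm (y, 0)) ∈ derivedSub F mul :=
        Submodule.subset_span ⟨_, _, rfl⟩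
      rw [← h, hK, he1] at this
      exact hxy (by simpa using this)

end Reverse

section Forward

variable {F : Type v} [Field F] {L : Type u} [AddCommGroup L] [Module F L] {mul : L → L → L}

lemma ker_mul (hbil : IsBilinearMul F mul) (hleib : IsLeftLeibnizMul mul) (y : L) :
    ∀ k ∈ leibKer F mul, mul k y = 0 := by
  obtain ⟨h1, h2, h3, h4⟩ := hbil
  intro k hk
  let f : L →ₗ[F] L := ⟨⟨fun x => mul x y, fun a b => h1 a b y⟩, fun c a => h3 c a y⟩
  have : leibKer F mul ≤ LinearMap.ker f := by
    rw [leibKer, Submodule.span_le]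
    rintro _ ⟨x, rfl⟩
    change mul (mul x x) y = 0
    have := hleib x x y
    simpa using this
  exact this hk

lemma mul_ker (hbil : IsBilinearMul F mul) (hleib : IsLeftLeibnizMul mul) (x : L) :
    ∀ k ∈ leibKer F mul, mul x k ∈ leibKer F mul := by
  obtain ⟨h1, h2, h3, h4⟩ := hbil
  intro k hk
  let f : L →ₗ[F] L := ⟨⟨fun y => mul x y, fun a b => h2 x a b⟩, fun c a => h4 c x a⟩
  have : leibKer F mul ≤ (leibKer F mul).comap f := by
    conv_lhs => rw [leibKer]
    rw [Submodule.span_le]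
    rintro _ ⟨y, rfl⟩
    change mul x (mul y y) ∈ leibKer F mul
    have hsq : ∀ z, mul z z ∈ leibKer F mul := fun z => Submodule.subset_span ⟨z, rfl⟩
    have : mul x (mul y y) = mul (mul x y + y) (mul x y + y) - mul (mul x y) (mul x y)
        - mul y y := by
      rw [hleib, h1, h2, h2]; abel
    rw [this]
    exact sub_mem (sub_mem (hsq _) (hsq _)) (hsq _)
  exact this hk

/-- left multiplication as an action of the quotient -/
def act (hbil : IsBilinearMul F mul) (hleib : IsLeftLeibnizMul mul) :
    (L ⧸ leibKer F mul) →ₗ[F] L →ₗ[F] L :=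
  (leibKer F mul).liftQ
    (LinearMap.mk₂ F mul hbil.1 hbil.2.2.1 hbil.2.1 hbil.2.2.2)
    (fun k hk => by
      rw [LinearMap.mem_ker]
      ext y
      exact ker_mul hbil hleib y k hk)

lemma act_mk (hbil : IsBilinearMul F mul) (hleib : IsLeftLeibnizMul mul) (x y : L) :
    act hbil hleib (Submodule.Quotient.mk x) y = mul x y := rfl

lemma act_mem (hbil : IsBilinearMul F mul) (hleib : IsLeftLeibnizMul mul)
    (q : L ⧸ leibKer F mul) :
    leibKer F mul ≤ (leibKer F mul).comap (act hbil hleib q) := by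
  obtain ⟨x, rfl⟩ := Submodule.Quotient.mk_surjective _ q
  exact fun k hk => mul_ker hbil hleib x k hk

/-- bracket on the quotient -/
def qbr (hbil : IsBilinearMul F mul) (hleib : IsLeftLeibnizMul mul)
    (q r : L ⧸ leibKer F mul) : L ⧸ leibKer F mul :=
  (leibKer F mul).mapQ (leibKer F mul) (act hbil hleib q) (act_mem hbil hleib q) r

lemma qbr_mk (hbil : IsBilinearMul F mul) (hleib : IsLeftLeibnizMul mul) (x y : L) :
    qbr hbil hleib (Submodule.Quotient.mk x) (Submodule.Quotient.mk y) =
      Submodule.Quotient.mk (mul x y) := rfl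

/-- Lie ring structure on the quotient -/
@[reducible] def qLieRing (hbil : IsBilinearMul F mul) (hleib : IsLeftLeibnizMul mul) :
    LieRing (L ⧸ leibKer F mul) where
  bracket := qbr hbil hleib
  add_lie a b c := by
    obtain ⟨x, rfl⟩ := Submodule.Quotient.mk_surjective _ a
    obtain ⟨y, rfl⟩ := Submodule.Quotient.mk_surjective _ b
    obtain ⟨z, rfl⟩ := Submodule.Quotient.mk_surjective _ c
    change qbr _ _ _ _ = qbr _ _ _ _ + qbr _ _ _ _
    rw [← Submodule.Quotient.mk_add, qbr_mk, qbr_mk, qbr_mk, ← Submodule.Quotient.mk_add, hbil.1]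
  lie_add a b c := map_add _ b c
  lie_self a := by
    obtain ⟨x, rfl⟩ := Submodule.Quotient.mk_surjective _ a
    change qbr _ _ _ _ = 0
    rw [qbr_mk, Submodule.Quotient.mk_eq_zero]
    exact Submodule.subset_span ⟨x, rfl⟩
  leibniz_lie a b c := by
    obtain ⟨x, rfl⟩ := Submodule.Quotient.mk_surjective _ a
    obtain ⟨y, rfl⟩ := Submodule.Quotient.mk_surjective _ b
    obtain ⟨z, rfl⟩ := Submodule.Quotient.mk_surjective _ c
    change qbr _ _ _ (qbr _ _ _ _) = qbr _ _ (qbr _ _ _ _) _ + qbr _ _ _ (qbr _ _ _ _)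
    simp only [qbr_mk]
    rw [hleib, Submodule.Quotient.mk_add]

/-- Lie algebra structure on the quotient -/
@[reducible] def qLieAlgebra (hbil : IsBilinearMul F mul) (hleib : IsLeftLeibnizMul mul) :
    letI := qLieRing hbil hleib
    LieAlgebra F (L ⧸ leibKer F mul) :=
  letI := qLieRing hbil hleib
  { lie_smul := fun c a b => map_smul ((leibKer F mul).mapQ (leibKer F mul)
      (act hbil hleib a) (act_mem hbil hleib a)) c b }

/-- the algebra as a module over the quotient -/
@[reducible] def qLieRingModule (hbil : IsBilinearMul F mul) (hleib : IsLeftLeibnizMul mul) :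
    letI := qLieRing hbil hleib
    LieRingModule (L ⧸ leibKer F mul) L :=
  letI := qLieRing hbil hleib
  { bracket := fun q y => act hbil hleib q y
    add_lie := fun a b c => by
      change act hbil hleib (a + b) c = _
      rw [map_add]; rfl
    lie_add := fun a b c => map_add _ b c
    leibniz_lie := fun a b c => by
      obtain ⟨x, rfl⟩ := Submodule.Quotient.mk_surjective _ a
      obtain ⟨y, rfl⟩ := Submodule.Quotient.mk_surjective _ b
      exact hleib x y c }

lemma qLieModule (hbil : IsBilinearMul F mul) (hleib : IsLeftLeibnizMul mul) :
    letI := qLieRing hbil hleib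
    letI := qLieAlgebra hbil hleib
    letI := qLieRingModule hbil hleib
    LieModule F (L ⧸ leibKer F mul) L :=
  letI := qLieRing hbil hleib
  letI := qLieAlgebra hbil hleib
  letI := qLieRingModule hbil hleib
  { smul_lie := fun c a b => by
      change act hbil hleib (c • a) b = _
      rw [map_smul]; rfl
    lie_smul := fun c a b => map_smul _ c b }

lemma q_simple (hbil : IsBilinearMul F mul) (hleib : IsLeftLeibnizMul mul)
    (hs : IsSimpleLeibniz F mul) :
    letI := qLieRing hbil hleib
    letI := qLieAlgebra hbil hleib
    IsSimpleLieDef F (L ⧸ leibKer F mul) := by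
  letI := qLieRing hbil hleib
  letI := qLieAlgebra hbil hleib
  refine ⟨?_, fun I hI => ?_⟩
  · by_contra! h
    refine hs.2.not_ge ?_
    rw [derivedSub, Submodule.span_le]
    rintro _ ⟨x, y, rfl⟩
    have := h (Submodule.Quotient.mk x) (Submodule.Quotient.mk y)
    exact (Submodule.Quotient.mk_eq_zero _).mp this
  · have hle : leibKer F mul ≤ I.comap (leibKer F mul).mkQ := by
      intro k hk
      have : (leibKer F mul).mkQ k = 0 := (Submodule.Quotient.mk_eq_zero _).mpr hk
      rw [Submodule.mem_comap, this]
      exact zero_mem _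
    have hmap := Submodule.map_comap_eq_of_surjective (Submodule.mkQ_surjective (leibKer F mul)) I
    have hbot : I.comap (leibKer F mul).mkQ = leibKer F mul → I = ⊥ := fun h => by
      rw [← hmap, h]
      simp
    rcases hs.1 (I.comap (leibKer F mul).mkQ)
      (fun x a ha => ⟨(hI (Submodule.Quotient.mk x) _ ha).1,
        (hI (Submodule.Quotient.mk x) _ ha).2⟩) with h | h | h
    · left
      apply hbot
      refine le_antisymm ?_ hle
      rw [h]; exact bot_le
    · exact Or.inl (hbot h)
    · right
      rw [← hmap, h]
      simp

lemma forward_hemi [CharZero F] [FiniteDimensional F L]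
    (hbil : IsBilinearMul F mul) (hleib : IsLeftLeibnizMul mul)
    (hs : IsSimpleLeibniz F mul) (hK : leibKer F mul ≠ ⊥) :
    ∃ (g : Type u) (_ : LieRing g) (_ : LieAlgebra F g)
          (M : Type u) (_ : AddCommGroup M) (_ : Module F M)
          (_ : LieRingModule g M) (_ : LieModule F g M),
          FiniteDimensional F g ∧ IsSimpleLieDef F g ∧
          FiniteDimensional F M ∧ (∃ (x : g) (m : M), ⁅x, m⁆ ≠ 0) ∧
          IsIrreducibleLieModule F g M ∧
          ∃ e : L ≃ₗ[F] g × M, ∀ x y : L, e (mul x y) = hemiMul (e x) (e y) := by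
  letI := qLieRing hbil hleib
  letI := qLieAlgebra hbil hleib
  letI := qLieRingModule hbil hleib
  haveI := qLieModule hbil hleib
  have hq := q_simple hbil hleib hs
  let p : L →ₗ⁅F, L ⧸ leibKer F mul⁆ (L ⧸ leibKer F mul) :=
    { (leibKer F mul).mkQ with
      map_lie' := fun {q y} => rfl }
  have hp : ∀ x, p x = Submodule.Quotient.mk x := fun _ => rfl
  have hact : ∀ x y : L, ⁅p x, y⁆ = mul x y := fun _ _ => rfl
  have hbr : ∀ x y : L, ⁅p x, p y⁆ = p (mul x y) := fun _ _ => rfl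
  have hps : Function.Surjective p := Submodule.mkQ_surjective _
  have hker : ∀ x, x ∈ p.ker ↔ x ∈ leibKer F mul := fun x => by
    rw [LieModuleHom.mem_ker, hp, Submodule.Quotient.mk_eq_zero]
  obtain ⟨σ, hσ1, hσ2⟩ := split (isSimpleLie_of_def hq) p hps
  have hmem : ∀ x, x - σ (p x) ∈ p.ker := fun x => by
    rw [LieModuleHom.mem_ker, map_sub, hσ1, sub_self]
  let e : L ≃ₗ[F] (L ⧸ leibKer F mul) × p.ker :=
    { toFun := fun x => (p x, ⟨x - σ (p x), hmem x⟩)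
      map_add' := fun x y => by
        refine Prod.ext (map_add p x y) (Subtype.ext ?_)
        change x + y - σ (p (x + y)) = (x - σ (p x)) + (y - σ (p y))
        rw [map_add, map_add]; abel
      map_smul' := fun c x => by
        refine Prod.ext (map_smul p c x) (Subtype.ext ?_)
        change c • x - σ (p (c • x)) = c • (x - σ (p x))
        rw [map_smul, map_smul, smul_sub]
      invFun := fun a => σ a.1 + a.2
      left_inv := fun x => by
        change σ (p x) + (x - σ (p x)) = x
        abel
      right_inv := fun a => by
        have h2 : p (a.2 : L) = 0 := a.2.2
        have h1 : p (σ a.1 + a.2) = a.1 := by rw [map_add, hσ1, h2, add_zero]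
        refine Prod.ext h1 (Subtype.ext ?_)
        change σ a.1 + a.2 - σ (p (σ a.1 + a.2)) = a.2
        rw [h1]; abel }
  have he : ∀ x y : L, e (mul x y) = hemiMul (e x) (e y) := fun x y => by
    refine Prod.ext rfl (Subtype.ext ?_)
    change mul x y - σ (p (mul x y)) = ⁅p x, y - σ (p y)⁆
    rw [lie_sub, hact, ← hσ2, hbr]
  refine ⟨L ⧸ leibKer F mul, inferInstance, inferInstance, p.ker, inferInstance, inferInstance,
    inferInstance, inferInstance, inferInstance, hq,
    inferInstanceAs (FiniteDimensional F p.ker.toSubmodule), ?_, ⟨?_, ?_⟩, e, he⟩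
  · by_contra! h
    apply hK
    rw [leibKer, Submodule.span_eq_bot]
    rintro _ ⟨x, rfl⟩
    apply e.injective
    rw [he, map_zero]
    exact Prod.ext (lie_self _) (h _ _)
  · obtain ⟨k, hk, hk0⟩ := Submodule.exists_mem_ne_zero_of_ne_bot hK
    exact ⟨⟨k, (hker k).mpr hk⟩, fun h => hk0 (congrArg Subtype.val h)⟩
  · intro N hN
    have hNK : ∀ a ∈ N.map p.ker.toSubmodule.subtype, a ∈ leibKer F mul := by
      rintro _ ⟨a, _, rfl⟩
      exact (hker _).mp a.2
    have htop : (leibKer F mul ≤ N.map p.ker.toSubmodule.subtype) → N = ⊤ := by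
      intro h
      rw [eq_top_iff]
      intro m _
      obtain ⟨a, ha, ham⟩ := h ((hker _).mp m.2)
      have : a = m := Subtype.ext ham
      rwa [← this]
    rcases hs.1 (N.map p.ker.toSubmodule.subtype) (fun x a ha => ⟨by
        obtain ⟨n, hn, rfl⟩ := ha
        exact ⟨_, hN (p x) n hn, rfl⟩, by
        rw [ker_mul hbil hleib x a (hNK a ha)]
        exact zero_mem _⟩) with h | h | h
    · left
      rw [eq_bot_iff]
      intro n hn
      have : (n : L) ∈ N.map p.ker.toSubmodule.subtype := ⟨n, hn, rfl⟩
      rw [h] at this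
      rw [Submodule.mem_bot]
      exact Subtype.ext ((Submodule.mem_bot F).mp this)
    · right
      exact htop h.ge
    · right
      exact htop (h ▸ le_top)

end Forward

end LeibAux

/-- In characteristic zero, a left Leibniz algebra `L` is
finite-dimensional simple if, and only if, either `L` is a finite-dimensional simple
Lie algebra, or `L` is isomorphic to the left hemi-semidirect product of a
finite-dimensional simple Lie algebra `g` and a non-trivial finite-dimensional
irreducible left `g`-module `M`. -/
theorem simple_structure_theorem (F : Type v) [Field F] [CharZero F]
    (L : Type u) [AddCommGroup L] [Module F L] (mul : L → L → L)
    (hbil : IsBilinearMul F mul) (hleib : IsLeftLeibnizMul mul) :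
    (FiniteDimensional F L ∧ IsSimpleLeibniz F mul) ↔
      ((FiniteDimensional F L ∧ (∀ x : L, mul x x = 0) ∧ IsSimpleMul F mul) ∨
        ∃ (g : Type u) (_ : LieRing g) (_ : LieAlgebra F g)
          (M : Type u) (_ : AddCommGroup M) (_ : Module F M)
          (_ : LieRingModule g M) (_ : LieModule F g M),
          FiniteDimensional F g ∧ IsSimpleLieDef F g ∧
          FiniteDimensional F M ∧ (∃ (x : g) (m : M), ⁅x, m⁆ ≠ 0) ∧
          IsIrreducibleLieModule F g M ∧
          ∃ e : L ≃ₗ[F] g × M, ∀ x y : L, e (mul x y) = hemiMul (e x) (e y)) := by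
  constructor
  · rintro ⟨hfd, hs⟩
    by_cases hK : leibKer F mul = ⊥
    · exact Or.inl ⟨hfd, LeibAux.forward_lie hK hs⟩
    · exact Or.inr (LeibAux.forward_hemi hbil hleib hs hK)
  · rintro (⟨hfd, h0, hs⟩ | ⟨g, _, _, M, _, _, _, _, hfg, hg, hfM, hnt, hirr, e, he⟩)
    · exact ⟨hfd, LeibAux.reverse_lie h0 hs⟩
    · exact ⟨Module.Finite.equiv e.symm, LeibAux.reverse_hemi hg hnt hirr e he⟩
end

section
/- Let F be a field of characteristic zero and let L be a finite-dimensional semi-simple left Leibniz algebra over F. Then L is ℤ₂-graded: there exists a subspace L₀ of L such that L is the direct sum L = L₀ ⊕ L₁ with L₁ := Leib(L), and L₀L₀ ⊆ L₀, L₀L₁ ⊆ L₁, L₁L₀ ⊆ L₁, and L₁L₁ ⊆ L₀ (indeed L₁L₁ = 0). -/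
universe u v w

open LieModule LieAlgebra

theorem aux_perfect (F g : Type*) [Field F] [CharZero F] [LieRing g] [LieAlgebra F g]
    [FiniteDimensional F g] [HasTrivialRadical F g] :
    (⁅(⊤ : LieIdeal F g), (⊤ : LieIdeal F g)⁆ : LieIdeal F g) = ⊤ := by
  set D : LieIdeal F g := ⁅(⊤ : LieIdeal F g), (⊤ : LieIdeal F g)⁆ with hD
  have hc := LieIdeal.isCompl_killingCompl (K := F) (L := g) D
  set C := LieIdeal.killingCompl F g D
  have hC : C = ⊥ := by
    apply (hasTrivialRadical_iff_no_abelian_ideals F g).1 inferInstance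
    refine ⟨fun x y => ?_⟩
    have h1 : (⁅x, y⁆ : C).1 ∈ D := by
      change ⁅(x : g), (y : g)⁆ ∈ D
      exact LieSubmodule.lie_mem_lie (LieSubmodule.mem_top _) (LieSubmodule.mem_top _)
    have h2 : (⁅x, y⁆ : C).1 ∈ C := (⁅x, y⁆ : C).2
    have h3 : (⁅x, y⁆ : C).1 ∈ D ⊓ C := ⟨h1, h2⟩
    rw [hc.inf_eq_bot] at h3
    exact Subtype.ext (by simpa using h3)
  have := hc.sup_eq_top
  rwa [hC, sup_bot_eq] at this

theorem aux_trivial (F g V : Type*) [Field F] [CharZero F] [LieRing g] [LieAlgebra F g]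
    [FiniteDimensional F g] [HasTrivialRadical F g] [AddCommGroup V] [Module F V]
    [LieRingModule g V] [LieModule F g V] [FiniteDimensional F V]
    (h : traceForm F g V = 0) (x : g) (v : V) : ⁅x, v⁆ = 0 := by
  have hn := LieModule.isNilpotent_derivedSeries_of_traceForm_eq_zero h
  have hp := aux_perfect F g
  have hn' : LieModule.IsNilpotent g V := by
    rw [LieModule.isNilpotent_iff_forall' (R := F)]
    intro x
    refine (LieModule.isNilpotent_iff_forall' (R := F)).mp hn ⟨x, ?_⟩
    change x ∈ (⁅(⊤ : LieIdeal F g), (⊤ : LieIdeal F g)⁆ : LieIdeal F g)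
    rw [hp]; trivial
  obtain ⟨k, hk⟩ := (LieModule.isNilpotent_iff F g V).1 hn'
  have key : ∀ k, ∀ x : g, ∀ v : V, ⁅x, v⁆ ∈ lowerCentralSeries F g V k := by
    intro k
    induction k with
    | zero => intro x v; simp
    | succ k ih =>
      intro x v
      have hx : x ∈ (⁅(⊤ : LieIdeal F g), (⊤ : LieIdeal F g)⁆ : LieIdeal F g) := by
        rw [hp]; trivial
      rw [← LieSubmodule.mem_toSubmodule, LieSubmodule.lieIdeal_oper_eq_linear_span'] at hx
      rw [lowerCentralSeries_succ]
      induction hx using Submodule.span_induction with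
      | mem y hy =>
        obtain ⟨a, -, b, -, rfl⟩ := hy
        rw [lie_lie]
        exact sub_mem (LieSubmodule.lie_mem_lie (LieSubmodule.mem_top _) (ih _ _))
          (LieSubmodule.lie_mem_lie (LieSubmodule.mem_top _) (ih _ _))
      | zero => simp
      | add a b _ _ ha hb => rw [add_lie]; exact add_mem ha hb
      | smul c a _ ha => rw [smul_lie]; exact Submodule.smul_mem _ _ ha
  have := key k x v
  rw [hk] at this
  simpa using this

theorem aux_casimir (F g V : Type*) [Field F] [CharZero F] [LieRing g] [LieAlgebra F g]
    [FiniteDimensional F g] [HasTrivialRadical F g] [AddCommGroup V] [Module F V]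
    [LieRingModule g V] [LieModule F g V] [FiniteDimensional F V]
    (h : traceForm F g V ≠ 0) : ∃ (n : ℕ) (a b : Fin n → g),
      (∀ (x : g) (B : g →ₗ[F] g →ₗ[F] V),
        ∑ i, (B ⁅x, a i⁆ (b i) + B (a i) ⁅x, b i⁆) = 0) ∧
      LinearMap.trace F V (∑ i, toEnd F g V (a i) ∘ₗ toEnd F g V (b i)) ≠ 0 := by
  set β := traceForm F g V with hβ
  let J : LieIdeal F g := 
    { LinearMap.ker β with
      lie_mem := by
        intro x m hm
        have hm' : β m = 0 := hm
        change β ⁅x, m⁆ = 0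
        ext z
        rw [hβ, traceForm_lieInvariant F g V x m z, ← hβ, hm']; simp }
  have hJ : ∀ y, y ∈ J ↔ β y = 0 := fun y => Iff.rfl
  have hc := LieIdeal.isCompl_killingCompl (K := F) (L := g) J
  set C := LieIdeal.killingCompl F g J
  let γ : LinearMap.BilinForm F C := β.compl₁₂ (C : Submodule F g).subtype (C : Submodule F g).subtype
  have hγ : ∀ x y : C, γ x y = β x y := fun _ _ => rfl
  have hsym : γ.IsSymm := ⟨fun x y => by simp only [hγ]; exact traceForm_comm F g V _ _⟩
  have hdec : ∀ z : g, ∃ j ∈ J, ∃ c ∈ C, j + c = z := by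
    intro z
    have : z ∈ J ⊔ C := by rw [hc.sup_eq_top]; trivial
    exact (LieSubmodule.mem_sup J C z).1 this
  have hzero : ∀ y : C, (∀ z : C, γ y z = 0) → y = 0 := by
    intro y hy
    have : (y : g) ∈ J ⊓ C := by
      refine ⟨(hJ _).2 ?_, y.2⟩
      ext z
      obtain ⟨j, hj, c, hcC, rfl⟩ := hdec z
      have e : β y j = 0 := by
        rw [hβ, traceForm_comm, ← hβ, (hJ _).1 hj]; rfl
      have := hy ⟨c, hcC⟩
      rw [hγ] at this
      rw [map_add, e]; simpa using this
    rw [hc.inf_eq_bot] at this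
    exact Subtype.ext (by simpa using this)
  have hnd : γ.Nondegenerate := by
    refine ⟨hzero, fun y hy => hzero y fun z => ?_⟩
    rw [← hsym.eq]; exact hy z
  let e := Module.finBasis F C
  let d := γ.dualBasis hnd e
  have inv : ∀ (x : g) (y z : C), γ ⁅x, y⁆ z = - γ y ⁅x, z⁆ := fun x y z =>
    traceForm_lieInvariant F g V x y z
  have exp_d : ∀ y : C, y = ∑ j, γ y (e j) • d j := by
    intro y
    conv_lhs => rw [← d.sum_repr y]
    simp [d, LinearMap.BilinForm.dualBasis_repr_apply]
  have exp_e : ∀ y : C, y = ∑ j, γ (d j) y • e j := by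
    intro y
    conv_lhs => rw [← e.sum_repr y]
    refine Finset.sum_congr rfl fun j _ => ?_
    congr 1
    have h1 : γ (d j) y = γ (d j) (∑ i, e.repr y i • e i) := by rw [e.sum_repr y]
    rw [h1, map_sum]
    simp only [map_smul, d, LinearMap.BilinForm.apply_dualBasis_left hnd]
    simp
  refine ⟨_, fun i => (e i : g), fun i => (d i : g), ?_, ?_⟩
  · intro x B
    let B' : C →ₗ[F] C →ₗ[F] V := B.compl₁₂ (C : Submodule F g).subtype (C : Submodule F g).subtype
    change ∑ i, (B' ⁅x, e i⁆ (d i) + B' (e i) ⁅x, d i⁆) = 0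
    rw [Finset.sum_add_distrib]
    have h1 : ∀ i, B' ⁅x, e i⁆ (d i) = ∑ j, γ (d j) ⁅x, e i⁆ • B' (e j) (d i) := by
      intro i
      conv_lhs => rw [exp_e ⁅x, e i⁆]
      simp
    have h2 : ∀ i, B' (e i) ⁅x, d i⁆ = ∑ j, γ ⁅x, d i⁆ (e j) • B' (e i) (d j) := by
      intro i
      conv_lhs => rw [exp_d ⁅x, d i⁆]
      simp
    simp_rw [h1, h2]
    conv_lhs => 
      arg 1
      rw [Finset.sum_comm]
    rw [← Finset.sum_add_distrib]
    refine Finset.sum_eq_zero fun i _ => ?_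
    rw [← Finset.sum_add_distrib]
    refine Finset.sum_eq_zero fun j _ => ?_
    rw [inv]; simp
  · rw [map_sum]
    have : ∀ i, LinearMap.trace F V (toEnd F g V (e i) ∘ₗ toEnd F g V (d i)) = 1 := by
      intro i
      rw [← traceForm_apply_apply]
      change γ (e i) (d i) = 1
      rw [LinearMap.BilinForm.apply_dualBasis_right hnd hsym]; simp
    rw [Finset.sum_congr rfl fun i _ => this i]
    simp only [Finset.sum_const, Finset.card_univ, Fintype.card_fin, nsmul_eq_mul, mul_one, ne_eq,
      Nat.cast_eq_zero]
    intro h0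
    apply h
    have hs : Subsingleton C := Module.finrank_zero_iff.1 h0
    ext z w
    obtain ⟨j, hj, c, hcC, rfl⟩ := hdec z
    have : c = 0 := congrArg Subtype.val (Subsingleton.elim (⟨c, hcC⟩ : C) 0)
    rw [this, add_zero, (hJ _).1 hj]; rfl

theorem aux_H1 (F : Type v) (g : Type w) [Field F] [CharZero F] [LieRing g] [LieAlgebra F g]
    [FiniteDimensional F g] [HasTrivialRadical F g] (n : ℕ) : 
    ∀ (V : Type u) [AddCommGroup V] [Module F V]
    [LieRingModule g V] [LieModule F g V] [FiniteDimensional F V], Module.finrank F V = n → 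
    ∀ φ : g →ₗ[F] V, (∀ x y, φ ⁅x, y⁆ = ⁅x, φ y⁆ - ⁅y, φ x⁆) → ∃ v, ∀ x, φ x = ⁅x, v⁆ := by
  induction n using Nat.strong_induction_on with
  | _ n IH =>
  intro V _ _ _ _ _ hV φ hφ
  by_cases h : traceForm F g V = 0
  · have ht := aux_trivial F g V h
    refine ⟨0, fun x => ?_⟩
    have hx : x ∈ (⁅(⊤ : LieIdeal F g), (⊤ : LieIdeal F g)⁆ : LieIdeal F g) := by
      rw [aux_perfect F g]; trivial
    rw [← LieSubmodule.mem_toSubmodule, LieSubmodule.lieIdeal_oper_eq_linear_span'] at hx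
    rw [lie_zero]
    induction hx using Submodule.span_induction with
    | mem y hy =>
      obtain ⟨a, -, b, -, rfl⟩ := hy
      rw [hφ, ht, ht, sub_zero]
    | zero => simp
    | add a b _ _ ha hb => rw [map_add, ha, hb, add_zero]
    | smul c a _ ha => rw [map_smul, ha, smul_zero]
  · obtain ⟨m, a, b, hinv, htr⟩ := aux_casimir F g V h
    set c : V →ₗ[F] V := ∑ i, toEnd F g V (a i) ∘ₗ toEnd F g V (b i) with hc
    have hcv : ∀ v, c v = ∑ i, ⁅a i, ⁅b i, v⁆⁆ := by intro v; simp [hc]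
    have hcomm : ∀ (x : g) v, c ⁅x, v⁆ = ⁅x, c v⁆ := by
      intro x v
      have := hinv x (LinearMap.mk₂ F (fun y z => ⁅y, ⁅z, v⁆⁆) (by simp) (by simp) (by simp) (by simp))
      simp only [LinearMap.mk₂_apply] at this
      rw [hcv, hcv, lie_sum, eq_comm, ← sub_eq_zero, ← Finset.sum_sub_distrib, ← this]
      refine Finset.sum_congr rfl fun i _ => ?_
      simp only [lie_lie, lie_sub]
      abel
    let w := ∑ i, ⁅a i, φ (b i)⁆
    have hw : ∀ x, c (φ x) = ⁅x, w⁆ := by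
      intro x
      have := hinv x (LinearMap.mk₂ F (fun y z => ⁅y, φ z⁆) (by simp) (by simp) (by simp) (by simp))
      simp only [LinearMap.mk₂_apply] at this
      rw [hcv, lie_sum, eq_comm, ← sub_eq_zero, ← Finset.sum_sub_distrib, ← this]
      refine Finset.sum_congr rfl fun i _ => ?_
      simp only [lie_lie, hφ, lie_sub]
      abel
    by_cases hinj : Function.Injective c
    · obtain ⟨v, hv⟩ := (LinearMap.injective_iff_surjective.1 hinj) w
      refine ⟨v, fun x => hinj ?_⟩
      rw [hw, hcomm, hv]
    · let cl : V →ₗ⁅F, g⁆ V := { c with map_lie' := by intro x v; exact hcomm x v }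
      have hcl : ∀ v, cl v = c v := fun _ => rfl
      let R : LieSubmodule F g V := cl.range
      let K : LieSubmodule F g V := cl.ker
      have hR : Module.finrank F R < n := by
        rw [← hV]
        apply Submodule.finrank_lt (s := (R : Submodule F V))
        intro ht
        apply hinj
        apply LinearMap.injective_iff_surjective.2
        intro v
        have : v ∈ (R : Submodule F V) := by rw [ht]; trivial
        have : v ∈ cl.range := this
        rw [LieModuleHom.mem_range] at this
        exact this
      have hK : Module.finrank F K < n := by
        rw [← hV]
        apply Submodule.finrank_lt (s := (K : Submodule F V))
        intro ht
        apply htr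
        have : c = 0 := by
          ext v
          have : v ∈ (K : Submodule F V) := by rw [ht]; trivial
          have : v ∈ cl.ker := this
          rw [LieModuleHom.mem_ker] at this
          exact this
        rw [this]; simp
      let φ₁ : g →ₗ[F] R := (c ∘ₗ φ).codRestrict (R : Submodule F V)
        (fun x => (LieModuleHom.mem_range cl _).2 ⟨φ x, rfl⟩)
      have hφ₁ : ∀ x, (φ₁ x : V) = c (φ x) := fun _ => rfl
      obtain ⟨⟨r, hr⟩, hr1⟩ := IH _ hR R rfl φ₁ (by
        intro x y
        apply Subtype.ext
        rw [LieSubmodule.coe_sub, LieSubmodule.coe_bracket, LieSubmodule.coe_bracket]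
        simp only [hφ₁, hφ, map_sub, hcomm])
      obtain ⟨v, hv⟩ := (LieModuleHom.mem_range cl _).1 hr
      let δ : g →ₗ[F] V := LinearMap.mk₂ F (fun (y : g) (z : V) => ⁅y, z⁆) (by simp) (by simp) (by simp) (by simp) |>.flip v
      have hδ : ∀ x, δ x = ⁅x, v⁆ := fun _ => rfl
      let φ₂ : g →ₗ[F] K := (φ - δ).codRestrict (K : Submodule F V) (by
        intro x
        refine (LieModuleHom.mem_ker (f := cl)).2 ?_
        rw [hcl, LinearMap.sub_apply, map_sub, ← hφ₁, hr1, hδ, hcomm, ← hcl v, hv]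
        simp)
      have hφ₂ : ∀ x, (φ₂ x : V) = φ x - ⁅x, v⁆ := fun _ => rfl
      obtain ⟨k, hk⟩ := IH _ hK K rfl φ₂ (by
        intro x y
        apply Subtype.ext
        rw [LieSubmodule.coe_sub, LieSubmodule.coe_bracket, LieSubmodule.coe_bracket]
        simp only [hφ₂, hφ, lie_sub, lie_lie]
        abel)
      refine ⟨v + k, fun x => ?_⟩
      have := congrArg Subtype.val (hk x)
      rw [LieSubmodule.coe_bracket, hφ₂] at this
      rw [lie_add, ← this]; abel

attribute [local instance 100] LieRing.ofAssociativeRing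

/-- Every finite-dimensional semi-simple left Leibniz algebra over a
field of characteristic zero is `ℤ₂`-graded, with `L₁ = Leib(L)` and `L₁L₁ = 0`. -/
theorem semisimple_z2Graded (F : Type v) [Field F] [CharZero F]
    (L : Type u) [AddCommGroup L] [Module F L] [FiniteDimensional F L]
    (mul : L → L → L) (hbil : IsBilinearMul F mul) (hleib : IsLeftLeibnizMul mul)
    (hss : IsSemisimpleLeibniz F mul) :
    ∃ L₀ : Submodule F L,
      (L₀ ⊓ leibKer F mul = ⊥ ∧ L₀ ⊔ leibKer F mul = ⊤) ∧
      (∀ a ∈ L₀, ∀ b ∈ L₀, mul a b ∈ L₀) ∧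
      (∀ a ∈ L₀, ∀ b ∈ leibKer F mul, mul a b ∈ leibKer F mul) ∧
      (∀ a ∈ leibKer F mul, ∀ b ∈ L₀, mul a b ∈ leibKer F mul) ∧
      (∀ a ∈ leibKer F mul, ∀ b ∈ leibKer F mul, mul a b = 0) := by
  obtain ⟨ha1, ha2, hs1, hs2⟩ := hbil
  let ℓ : L →ₗ[F] Module.End F L := LinearMap.mk₂ F mul ha1 hs1 ha2 hs2
  have hℓ : ∀ x y, ℓ x y = mul x y := fun _ _ => rfl
  have hbr : ∀ x y, ⁅ℓ x, ℓ y⁆ = ℓ (mul x y) := by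
    intro x y
    ext z
    rw [Ring.lie_def, LinearMap.sub_apply, Module.End.mul_apply, Module.End.mul_apply]
    simp only [hℓ]
    rw [hleib x y z]; abel
  -- the kernel acts trivially from the left
  have hker : ∀ a ∈ leibKer F mul, ℓ a = 0 := by
    intro a ha
    have : leibKer F mul ≤ LinearMap.ker ℓ := by
      refine Submodule.span_le.2 ?_
      rintro _ ⟨x, rfl⟩
      change ℓ (mul x x) = 0
      rw [← hbr, lie_self]
    exact this ha
  have hker' : ∀ a ∈ leibKer F mul, ∀ b, mul a b = 0 := by
    intro a ha b
    rw [← hℓ, hker a ha]; rfl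
  -- the kernel is stable under left multiplication
  have hsq : ∀ x, mul x x ∈ leibKer F mul := fun x => Submodule.subset_span ⟨x, rfl⟩
  have hstab : ∀ x, ∀ b ∈ leibKer F mul, mul x b ∈ leibKer F mul := by
    intro x b hb
    have h1 : mul x b = mul (x + b) (x + b) - mul x x := by
      rw [ha1, ha2, hker' b hb]; abel
    rw [h1]
    exact sub_mem (hsq _) (hsq _)
  let g : LieSubalgebra F (Module.End F L) :=
    { LinearMap.range ℓ with
      lie_mem' := by
        rintro _ _ ⟨x, rfl⟩ ⟨y, rfl⟩
        exact ⟨mul x y, (hbr x y).symm⟩ }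
  let m : L → g := fun x => ⟨ℓ x, x, rfl⟩
  have hm : ∀ x y : L, ⁅m x, y⁆ = mul x y := fun _ _ => rfl
  have hsurj : ∀ z : g, ∃ x, z = m x := by
    rintro ⟨_, x, rfl⟩
    exact ⟨x, rfl⟩
  have hmbr : ∀ x y, ⁅m x, m y⁆ = m (mul x y) := fun x y => Subtype.ext (hbr x y)
  have hrad : HasTrivialRadical F g := by
    rw [hasTrivialRadical_iff_no_abelian_ideals]
    intro I hI
    let ml : L →ₗ[F] g := ℓ.codRestrict g.toSubmodule (fun x => ⟨x, rfl⟩)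
    have hml : ∀ x, ml x = m x := fun _ => rfl
    let J : Submodule F L := (I : Submodule F g).comap ml
    have hJ : ∀ x, x ∈ J ↔ m x ∈ I := fun _ => Iff.rfl
    have hJi : IsIdealOf F mul J := by
      intro x a ha
      rw [hJ] at ha
      rw [hJ, hJ, ← hmbr, ← hmbr]
      exact ⟨lie_mem_right F g I _ _ ha, lie_mem_left F g I _ _ ha⟩
    have h1 : ∀ a ∈ J, ∀ b ∈ J, ℓ (mul a b) = 0 := by
      intro a ha b hb
      have : ⁅(⟨m a, ha⟩ : I), (⟨m b, hb⟩ : I)⁆ = 0 := hI.trivial _ _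
      have h2 : ⁅m a, m b⁆ = 0 := congrArg Subtype.val this
      rw [hmbr] at h2
      exact congrArg Subtype.val h2
    have h2 : derSeries F mul J 1 ≤ LinearMap.ker ℓ := by
      refine Submodule.span_le.2 ?_
      rintro _ ⟨a, ha, b, hb, rfl⟩
      exact h1 a ha b hb
    have hJs : IsSolvableSub F mul J := by
      refine ⟨2, ?_⟩
      refine (Submodule.span_eq_bot).2 ?_
      rintro _ ⟨a, ha, b, hb, rfl⟩
      have : ℓ a = 0 := h2 ha
      rw [← hℓ, this]; rfl
    have h3 := hss J hJi hJs
    rw [eq_bot_iff]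
    intro z hz
    obtain ⟨x, rfl⟩ := hsurj z
    have := hker x (h3 hz)
    rw [LieSubmodule.mem_bot]
    exact Subtype.ext this
  -- the module of maps `L → Leib(L)` vanishing on `Leib(L)`
  let M : LieSubmodule F g (L →ₗ[F] L) :=
    { carrier := {f | (∀ x, f x ∈ leibKer F mul) ∧ ∀ x ∈ leibKer F mul, f x = 0}
      add_mem' := fun {a b} ha hb => ⟨fun x => add_mem (ha.1 x) (hb.1 x), fun x hx => by
        rw [LinearMap.add_apply, ha.2 x hx, hb.2 x hx, add_zero]⟩
      zero_mem' := ⟨fun x => zero_mem _, fun x _ => rfl⟩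
      smul_mem' := fun c f hf => ⟨fun x => Submodule.smul_mem _ _ (hf.1 x), fun x hx => by
        rw [LinearMap.smul_apply, hf.2 x hx, smul_zero]⟩
      lie_mem := by
        intro z f hf
        obtain ⟨y, rfl⟩ := hsurj z
        refine ⟨fun x => ?_, fun x hx => ?_⟩
        · rw [LieHom.lie_apply, hm, hm]
          exact sub_mem (hstab _ _ (hf.1 x)) (hf.1 _)
        · rw [LieHom.lie_apply, hm, hm, hf.2 x hx, hf.2 _ (hstab y x hx), ← hm, lie_zero, sub_zero] }
  obtain ⟨p, hp⟩ := (leibKer F mul).subtype.exists_leftInverse_of_injective (by simp)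
  let P : L →ₗ[F] L := (leibKer F mul).subtype ∘ₗ p
  have hP1 : ∀ x, P x ∈ leibKer F mul := fun x => (p x).2
  have hP2 : ∀ x ∈ leibKer F mul, P x = x := fun x hx =>
    congrArg Subtype.val (LinearMap.congr_fun hp ⟨x, hx⟩)
  let δ : g →ₗ[F] (L →ₗ[F] L) := (LinearMap.mk₂ F (fun (y : g) (z : L →ₗ[F] L) => ⁅y, z⁆)
    (by intros; simp) (by intros; simp) (by intros; simp) (by intros; simp)).flip P
  have hδ : ∀ x, δ x = ⁅x, P⁆ := fun _ => rfl
  let φ : g →ₗ[F] M := δ.codRestrict (M : Submodule F (L →ₗ[F] L)) (by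
    intro z
    obtain ⟨y, rfl⟩ := hsurj z
    rw [hδ]
    refine ⟨fun x => ?_, fun x hx => ?_⟩
    · rw [LieHom.lie_apply, hm, hm]
      exact sub_mem (hstab _ _ (hP1 x)) (hP1 _)
    · rw [LieHom.lie_apply, hm, hm, hP2 x hx, hP2 _ (hstab y x hx), sub_self])
  have hφ : ∀ x, (φ x : L →ₗ[F] L) = ⁅x, P⁆ := fun _ => rfl
  obtain ⟨⟨q, hq⟩, hq1⟩ := aux_H1 F g _ M rfl φ (by
    intro x y
    apply Subtype.ext
    rw [LieSubmodule.coe_sub, LieSubmodule.coe_bracket, LieSubmodule.coe_bracket]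
    simp only [hφ, lie_lie])
  have hq2 : ∀ x : g, ⁅x, P⁆ = ⁅x, q⁆ := fun x => congrArg Subtype.val (hq1 x)
  have hcomm : ∀ x y, (P - q) (mul x y) = mul x ((P - q) y) := by
    intro x y
    have h1 : ⁅m x, P - q⁆ = 0 := by rw [lie_sub, hq2, sub_self]
    have h2 := LinearMap.congr_fun h1 y
    rw [LieHom.lie_apply, hm, hm] at h2
    exact (sub_eq_zero.1 h2).symm
  have hr1 : ∀ x, (P - q) x ∈ leibKer F mul := fun x => sub_mem (hP1 x) (hq.1 x)
  have hr2 : ∀ x ∈ leibKer F mul, (P - q) x = x := fun x hx => by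
    rw [LinearMap.sub_apply, hP2 x hx, hq.2 x hx, sub_zero]
  refine ⟨LinearMap.ker (P - q), ⟨?_, ?_⟩, ?_, fun a _ => hstab a, ?_, fun a ha b _ => hker' a ha b⟩
  · rw [eq_bot_iff]
    rintro x ⟨h1, h2⟩
    have h1' : (P - q) x = 0 := h1
    rw [hr2 x h2] at h1'
    exact h1'
  · rw [eq_top_iff]
    intro x _
    refine Submodule.mem_sup.2 ⟨x - (P - q) x, ?_, (P - q) x, hr1 x, by abel⟩
    rw [LinearMap.mem_ker, map_sub, hr2 _ (hr1 x), sub_self]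
  · intro a _ b hb
    rw [LinearMap.mem_ker] at hb ⊢
    rw [hcomm, hb, ← hℓ, map_zero]
  · intro a ha b _
    rw [hker' a ha]; exact zero_mem _
end

section
/- Let F be a field of characteristic zero and let L be a finite-dimensional semi-simple left Leibniz algebra over F. Then the right center of L vanishes: C^r(L) = 0, i.e., if c ∈ L satisfies xc = 0 for all x ∈ L, then c = 0. -/
universe u v w

section
attribute [local instance 100] LieRing.ofAssociativeRing
theorem faithful_nilp {F K V : Type*} [Field F] [LieRing K] [LieAlgebra F K] [AddCommGroup V] [Module F V]
   [LieRingModule K V] [LieModule F K V] [FiniteDimensional F K] [FiniteDimensional F V]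
   (hf : ∀ x : K, (∀ v : V, ⁅x, v⁆ = 0) → x = 0)
   (hn : LieModule.IsNilpotent K V) : LieRing.IsNilpotent K := by
  rw [LieAlgebra.isNilpotent_iff_forall (R := F)]
  intro x
  have h1 := (LieModule.isNilpotent_iff_forall' (R := F)).mp hn x
  obtain ⟨n, h2⟩ := LieAlgebra.ad_nilpotent_of_nilpotent (R := F) h1
  refine ⟨n, ?_⟩
  have key : ∀ (m : ℕ) (y : K), LieModule.toEnd F K V (((LieAlgebra.ad F K x)^m) y) =
      ((LieAlgebra.ad F (Module.End F V) (LieModule.toEnd F K V x))^m) (LieModule.toEnd F K V y) := by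
    intro m
    induction m with
    | zero => intro y; simp
    | succ m ih => 
      intro y
      rw [pow_succ, pow_succ, Module.End.mul_apply, Module.End.mul_apply, ih]
      simp
  ext y
  have h3 := key n y
  rw [h2] at h3
  apply hf
  intro v
  exact LinearMap.congr_fun h3 v
end

theorem compl_nondeg {F g V : Type*} [Field F] [CharZero F] [LieRing g] [LieAlgebra F g]
   [AddCommGroup V] [Module F V]
   [LieRingModule g V] [LieModule F g V] [FiniteDimensional F g] [FiniteDimensional F V]
   [LieAlgebra.HasTrivialRadical F g] : ∃ I : LieIdeal F g,
     (∀ x : g, ∃ y ∈ I, ∀ v : V, ⁅x, v⁆ = ⁅y, v⁆) ∧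
     (∀ x ∈ I, (∀ y ∈ I, LieModule.traceForm F g V x y = 0) → x = 0) := by
  refine ⟨(LieModule.ker F g V).killingCompl, ?_⟩
  set I := (LieModule.ker F g V).killingCompl with hI
  have hc : IsCompl (LieModule.ker F g V) I := LieIdeal.isCompl_killingCompl _
  have h1 : ∀ x : g, ∃ y ∈ I, ∀ v : V, ⁅x, v⁆ = ⁅y, v⁆ := by
    intro x
    have hx : x ∈ (LieModule.ker F g V) ⊔ I := by rw [hc.sup_eq_top]; trivial
    obtain ⟨a, ha, b, hb, rfl⟩ := LieSubmodule.mem_sup _ _ _ |>.mp hx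
    refine ⟨b, hb, fun v => ?_⟩
    rw [LieModule.mem_ker] at ha
    simp [ha v]
  refine ⟨h1, ?_⟩
  set N := LieAlgebra.InvariantForm.orthogonal (LieModule.traceForm F g V)
    (LieModule.traceForm_lieInvariant F g V) (⊤ : LieIdeal F g) with hN
  set J : LieIdeal F g := N ⊓ I with hJ
  have hJf : ∀ x ∈ J, (∀ v : V, ⁅x, v⁆ = 0) → x = 0 := by
    intro x hx h
    have : x ∈ (LieModule.ker F g V) ⊓ I := ⟨(LieModule.mem_ker F g V x).mpr h, hx.2⟩
    rwa [hc.inf_eq_bot, LieSubmodule.mem_bot] at this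
  have htr : LieModule.traceForm F J V = 0 := by
    ext ⟨x, hx⟩ ⟨y, hy⟩
    have := (LieAlgebra.InvariantForm.mem_orthogonal _ _ _ y).mp hy.1 x trivial
    exact this
  have hnil := LieModule.isNilpotent_derivedSeries_of_traceForm_eq_zero htr
  have hnil2 : LieRing.IsNilpotent (LieAlgebra.derivedSeries F J 1) := by
    apply faithful_nilp (F := F) (V := V) _ hnil
    rintro ⟨⟨x, hx⟩, hx'⟩ h
    have := hJf x hx h
    ext
    exact this
  have hsol : LieAlgebra.IsSolvable J := by
    obtain ⟨k, hk⟩ := LieAlgebra.IsSolvable.solvable F (LieAlgebra.derivedSeries F J 1)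
    rw [LieIdeal.derivedSeries_eq_bot_iff] at hk
    refine LieAlgebra.IsSolvable.mk (R := F) (k := k + 1) ?_
    rw [LieAlgebra.derivedSeries_def, LieAlgebra.derivedSeriesOfIdeal_add]
    exact hk
  have hbot : J = ⊥ := LieAlgebra.HasTrivialRadical.eq_bot_of_isSolvable J
  intro x hx h
  have : x ∈ J := by
    refine ⟨?_, hx⟩
    apply (LieAlgebra.InvariantForm.mem_orthogonal _ _ _ x).mpr
    intro z _
    obtain ⟨y, hy, hyz⟩ := h1 z
    have e : LieModule.toEnd F g V z = LieModule.toEnd F g V y := by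
      ext v; exact hyz v
    rw [LieModule.traceForm_comm, ← h y hy, LieModule.traceForm_apply_apply, LieModule.traceForm_apply_apply, e]
  rwa [hbot, LieSubmodule.mem_bot] at this

theorem exists_casimir {F g V : Type*} [Field F] [CharZero F] [LieRing g] [LieAlgebra F g]
   [AddCommGroup V] [Module F V]
   [LieRingModule g V] [LieModule F g V] [FiniteDimensional F g] [FiniteDimensional F V]
   [LieAlgebra.HasTrivialRadical F g] : ∃ Ω : Module.End F V,
     (∀ (x : g) (v : V), Ω ⁅x, v⁆ = ⁅x, Ω v⁆) ∧
     (∀ v : V, (∀ x : g, ⁅x, v⁆ = 0) → Ω v = 0) ∧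
     (IsNilpotent Ω → ∀ (x : g) (v : V), ⁅x, v⁆ = 0) := by
  classical
  obtain ⟨I, h1, h2⟩ := compl_nondeg (F := F) (g := g) (V := V)
  set B : LinearMap.BilinForm F I := LieModule.traceForm F I V with hB
  have hBa : ∀ x y : I, B x y = LieModule.traceForm F g V x y := fun x y => rfl
  have hsymm : B.IsSymm := ⟨fun x y => LieModule.traceForm_comm F I V x y⟩
  have hnd : B.Nondegenerate := by
    refine (LieModule.traceForm_isSymm F I V).isRefl.nondegenerate_iff_separatingLeft.mpr ?_
    rintro ⟨x, hx⟩ h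
    ext
    exact h2 x hx (fun y hy => h ⟨y, hy⟩)
  let b := Module.finBasis F I
  let b' := B.dualBasis hnd b
  have e1 : ∀ y : I, y = ∑ j, B y (b j) • b' j := by
    intro y
    conv_lhs => rw [← b'.sum_repr y]
    simp only [b', LinearMap.BilinForm.dualBasis_repr_apply]
  have e2 : ∀ y : I, y = ∑ j, B y (b' j) • b j := by
    intro y
    conv_lhs => rw [← b.sum_repr y]
    refine Finset.sum_congr rfl fun j _ => ?_
    congr 1
    have : B y (b' j) = B (∑ i, b.repr y i • b i) (b' j) := by rw [b.sum_repr]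
    rw [this]
    simp only [map_sum, map_smul, LinearMap.sum_apply, LinearMap.smul_apply, b', LinearMap.BilinForm.apply_dualBasis_right hnd hsymm]
    simp
  refine ⟨∑ i, LieModule.toEnd F I V (b i) * LieModule.toEnd F I V (b' i), ?_, ?_, ?_⟩
  · intro x v
    -- action of x on I
    have inv : ∀ y z : I, B ⁅x, y⁆ z = - B y ⁅x, z⁆ := by
      intro y z
      exact LieModule.traceForm_lieInvariant F g V x y z
    have act : ∀ (y : I) (w : V), ⁅x, ⁅y, w⁆⁆ = ⁅(⁅x, y⁆ : I), w⁆ + ⁅y, ⁅x, w⁆⁆ := by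
      intro y w
      exact leibniz_lie x (y : g) w
    have s1 : ∑ i, ⁅(⁅x, b i⁆ : I), ⁅b' i, v⁆⁆ =
        ∑ i, ∑ j, B ⁅x, b i⁆ (b' j) • ⁅b j, ⁅b' i, v⁆⁆ := by
      refine Finset.sum_congr rfl fun i _ => ?_
      conv_lhs => rw [e2 ⁅x, b i⁆]
      rw [sum_lie]
      simp
    have s2 : ∑ i, ⁅b i, ⁅(⁅x, b' i⁆ : I), v⁆⁆ =
        ∑ i, ∑ j, B ⁅x, b' i⁆ (b j) • ⁅b i, ⁅b' j, v⁆⁆ := by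
      refine Finset.sum_congr rfl fun i _ => ?_
      conv_lhs => rw [e1 ⁅x, b' i⁆]
      rw [sum_lie, lie_sum]
      simp
    have s3 : ∑ i, ⁅(⁅x, b i⁆ : I), ⁅b' i, v⁆⁆ + ∑ i, ⁅b i, ⁅(⁅x, b' i⁆ : I), v⁆⁆ = 0 := by
      rw [s1, s2, Finset.sum_comm, ← Finset.sum_add_distrib]
      refine Finset.sum_eq_zero fun i _ => ?_
      rw [← Finset.sum_add_distrib]
      refine Finset.sum_eq_zero fun j _ => ?_
      rw [← add_smul, inv, hsymm.eq (b j), neg_add_cancel, zero_smul]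
    simp only [LinearMap.sum_apply, Module.End.mul_apply, LieModule.toEnd_apply_apply]
    rw [lie_sum]
    simp only [act, lie_add, Finset.sum_add_distrib]
    rw [← add_assoc, s3, zero_add]
  · intro v hv
    simp only [LinearMap.sum_apply, Module.End.mul_apply, LieModule.toEnd_apply_apply]
    refine Finset.sum_eq_zero fun i _ => ?_
    have : ⁅b' i, v⁆ = 0 := hv (b' i)
    rw [this, lie_zero]
  · intro hn
    have ht := (LinearMap.isNilpotent_trace_of_isNilpotent hn).eq_zero
    have : ∀ i, LinearMap.trace F V (LieModule.toEnd F I V (b i) * LieModule.toEnd F I V (b' i)) = 1 := by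
      intro i
      have := LinearMap.BilinForm.apply_dualBasis_right hnd hsymm b i i
      rw [if_pos rfl] at this
      exact this
    rw [map_sum] at ht
    simp only [this] at ht
    simp at ht
    intro x v
    obtain ⟨y, hy, h⟩ := h1 x
    rw [h]
    have : (⟨y, hy⟩ : I) = 0 := by
      have := Module.finrank_zero_iff.mp ht
      exact Subsingleton.elim _ _
    have : y = 0 := congrArg Subtype.val this
    rw [this, zero_lie]

theorem inv_inf_span {F g : Type*} [Field F] [CharZero F] [LieRing g] [LieAlgebra F g]
   [FiniteDimensional F g] [LieAlgebra.HasTrivialRadical F g] (n : ℕ) :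
   ∀ (V : Type u) [AddCommGroup V] [Module F V]
   [LieRingModule g V] [LieModule F g V] [FiniteDimensional F V], Module.finrank F V = n →
   ∀ v : V, (∀ x : g, ⁅x, v⁆ = 0) → v ∈ Submodule.span F {m : V | ∃ (x : g) (w : V), m = ⁅x, w⁆} →
   v = 0 := by
  induction n using Nat.strong_induction_on with
  | _ n ih =>
  intro V _ _ _ _ _ hV v hv hs
  obtain ⟨Ω, c1, c2, c3⟩ := exists_casimir (F := F) (g := g) (V := V)
  by_cases hn : IsNilpotent Ω
  · have := c3 hn
    have hle : Submodule.span F {m : V | ∃ (x : g) (w : V), m = ⁅x, w⁆} ≤ ⊥ := by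
      rw [Submodule.span_le]
      rintro _ ⟨x, w, rfl⟩
      exact this x w
    exact (Submodule.mem_bot F).mp (hle hs)
  · obtain ⟨k, hk⟩ := (Filter.eventually_atTop.mp Ω.eventually_isCompl_ker_pow_range_pow)
    have hc := hk (k+1) (by omega)
    have c1' : ∀ (m : ℕ) (x : g) (v : V), (Ω^m) ⁅x, v⁆ = ⁅x, (Ω^m) v⁆ := by
      intro m x
      induction m with
      | zero => simp
      | succ m ih2 => intro v; rw [pow_succ, Module.End.mul_apply, c1, ih2, Module.End.mul_apply]
    let N : LieSubmodule F g V :=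
      { LinearMap.range (Ω^(k+1)) with
        lie_mem := by
          rintro x _ ⟨w, rfl⟩
          exact ⟨⁅x, w⁆, c1' _ x w⟩ }
    have hN : ∀ w, w ∈ N ↔ w ∈ LinearMap.range (Ω^(k+1)) := fun w => Iff.rfl
    have hlt : Module.finrank F (V ⧸ N) < n := by
      have h3 := Submodule.finrank_quotient_add_finrank (R := F) (LinearMap.range (Ω^(k+1)))
      have h4 : 0 < Module.finrank F (LinearMap.range (Ω^(k+1))) := by
        rw [Nat.pos_iff_ne_zero]
        intro h0
        apply hn
        refine ⟨k+1, ?_⟩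
        rw [Submodule.finrank_eq_zero] at h0
        exact LinearMap.range_eq_bot.mp h0
      have h5 : Module.finrank F (V ⧸ N) = Module.finrank F (V ⧸ LinearMap.range (Ω^(k+1))) := rfl
      omega
    have : FiniteDimensional F (V ⧸ N) :=
      inferInstanceAs (FiniteDimensional F (V ⧸ LinearMap.range (Ω^(k+1))))
    have key := ih _ hlt (V ⧸ N) rfl (LieSubmodule.Quotient.mk' N v) (by
      intro x
      rw [← LieModuleHom.map_lie, hv, map_zero]) (by
      have := Submodule.mem_map_of_mem (f := (LieSubmodule.Quotient.mk' N : V →ₗ[F] V ⧸ N)) hs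
      rw [Submodule.map_span] at this
      refine Submodule.span_mono ?_ this
      rintro _ ⟨_, ⟨x, w, rfl⟩, rfl⟩
      exact ⟨x, LieSubmodule.Quotient.mk' N w, LieModuleHom.map_lie (LieSubmodule.Quotient.mk' N) x w⟩)
    rw [LieSubmodule.Quotient.mk_eq_zero] at key
    have hker : v ∈ LinearMap.ker (Ω^(k+1)) := by
      rw [LinearMap.mem_ker, pow_succ, Module.End.mul_apply, c2 v hv, map_zero]
    exact (Submodule.disjoint_def.mp hc.disjoint) v hker key

section
attribute [local instance 100] LieRing.ofAssociativeRing

theorem semisimple_aux (F : Type v) [Field F] [CharZero F]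
    (L : Type u) [AddCommGroup L] [Module F L] [FiniteDimensional F L]
    (mul : L → L → L) (hbil : IsBilinearMul F mul) (hleib : IsLeftLeibnizMul mul)
    (hss : IsSemisimpleLeibniz F mul) :
    ∀ c : L, (∀ x : L, mul x c = 0) → c = 0 := by
  obtain ⟨b1, b2, b3, b4⟩ := hbil
  let lm : L →ₗ[F] Module.End F L := LinearMap.mk₂ F mul b1 b3 b2 b4
  have lma : ∀ x y, lm x y = mul x y := fun x y => rfl
  have mz : ∀ x, mul 0 x = 0 := fun x => by rw [← lma]; simp
  have lmm : ∀ x y, lm (mul x y) = ⁅lm x, lm y⁆ := by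
    intro x y
    ext z
    rw [LieRing.of_associative_ring_bracket]
    simp only [LinearMap.sub_apply, Module.End.mul_apply, lma]
    rw [hleib x y z]; abel
  let g : LieSubalgebra F (Module.End F L) :=
    { LinearMap.range lm with
      lie_mem' := by
        rintro _ _ ⟨x, rfl⟩ ⟨y, rfl⟩
        exact ⟨mul x y, lmm x y⟩ }
  let ρ : L →ₗ[F] g := lm.codRestrict g.toSubmodule (fun x => ⟨x, rfl⟩)
  have ρs : ∀ y : g, ∃ x, ρ x = y := by
    rintro ⟨_, x, rfl⟩
    exact ⟨x, rfl⟩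
  have ρm : ∀ x y, ρ (mul x y) = ⁅ρ x, ρ y⁆ := fun x y => Subtype.ext (lmm x y)
  have ρa : ∀ x y, ⁅ρ x, y⁆ = mul x y := fun x y => rfl
  have ρ0 : ∀ x, ρ x = 0 → ∀ y, mul x y = 0 := by
    intro x hx y
    rw [← ρa, hx, zero_lie]
  have solv : ∀ P : Submodule F L, IsIdealOf F mul P →
      (∀ a ∈ P, ∀ b ∈ P, ρ (mul a b) = 0) → P ≤ leibKer F mul := by
    intro P hP h
    refine hss P hP ⟨2, ?_⟩
    have h1 : derSeries F mul P 1 ≤ LinearMap.ker ρ := by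
      refine Submodule.span_le.mpr ?_
      rintro _ ⟨a, ha, b, hb, rfl⟩
      exact h a ha b hb
    rw [eq_bot_iff]
    refine Submodule.span_le.mpr ?_
    rintro _ ⟨a, ha, b, hb, rfl⟩
    exact ρ0 a (h1 ha) b
  have sq0 : leibKer F mul ≤ LinearMap.ker ρ := by
    refine Submodule.span_le.mpr ?_
    rintro _ ⟨x, rfl⟩
    change ρ (mul x x) = 0
    rw [ρm, lie_self]
  have hrad : LieAlgebra.HasTrivialRadical F g := by
    rw [LieAlgebra.hasTrivialRadical_iff_no_abelian_ideals]
    intro I hI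
    have hP := solv (I.toSubmodule.comap ρ) (by
      intro x a ha
      have ha : ρ a ∈ I := ha
      constructor
      · change ρ (mul x a) ∈ I
        rw [ρm]; exact lie_mem_right F g I _ _ ha
      · change ρ (mul a x) ∈ I
        rw [ρm]; exact lie_mem_left F g I _ _ ha) (by
      intro a ha b hb
      rw [ρm]
      have := hI.trivial ⟨ρ a, ha⟩ ⟨ρ b, hb⟩
      exact congrArg Subtype.val this)
    rw [eq_bot_iff]
    intro y hy
    obtain ⟨x, rfl⟩ := ρs y
    exact (LieSubmodule.mem_bot _).mpr (sq0 (hP hy))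
  intro c hc
  have hcK : c ∈ leibKer F mul := by
    have hle := solv (LinearMap.ker ρ) (by
      intro x a ha
      have ha : ρ a = 0 := ha
      constructor
      · change ρ (mul x a) = 0
        rw [ρm, ha, lie_zero]
      · change ρ (mul a x) = 0
        rw [ρm, ha, zero_lie]) (by
      intro a ha b hb
      have ha : ρ a = 0 := ha
      rw [ρm, ha, zero_lie])
    apply hle
    have : ρ c ∈ LieAlgebra.center F g := by
      rw [LieModule.mem_maxTrivSubmodule]
      intro y
      obtain ⟨x, rfl⟩ := ρs y
      rw [← ρm, hc, map_zero]
    rw [LieAlgebra.center_eq_bot, LieSubmodule.mem_bot] at this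
    exact this
  refine inv_inf_span (F := F) (g := g) _ L rfl c ?_ ?_
  · intro y
    obtain ⟨x, rfl⟩ := ρs y
    exact hc x
  · refine Submodule.span_mono ?_ hcK
    rintro _ ⟨x, rfl⟩
    exact ⟨ρ x, x, rfl⟩
end

theorem semisimple_rightCenter_eq_bot (F : Type v) [Field F] [CharZero F]
    (L : Type u) [AddCommGroup L] [Module F L] [FiniteDimensional F L]
    (mul : L → L → L) (hbil : IsBilinearMul F mul) (hleib : IsLeftLeibnizMul mul)
    (hss : IsSemisimpleLeibniz F mul) :
    ∀ c : L, (∀ x : L, mul x c = 0) → c = 0 :=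
  semisimple_aux F L mul hbil hleib hss
end

section
/- Let F be a field of characteristic zero and let L be a finite-dimensional semi-simple left Leibniz algebra over F that is left central, i.e., Leib(L) ⊆ C^r(L). Then L is a Lie algebra, i.e., xx = 0 for all x ∈ L (equivalently, Leib(L) = 0). -/
universe u v w

section Aux

variable {F : Type v} [Field F] {L : Type u} [AddCommGroup L] [Module F L]

/-- Descend a bilinear map to the quotient. -/
def auxLift₂ {M : Type w} [AddCommGroup M] [Module F M] (K : Submodule F L)
    (B : L →ₗ[F] L →ₗ[F] M) (h1 : ∀ c ∈ K, ∀ x, B c x = 0) (h2 : ∀ c ∈ K, ∀ x, B x c = 0) :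
    (L ⧸ K) →ₗ[F] (L ⧸ K) →ₗ[F] M :=
  K.liftQ (LinearMap.flip (K.liftQ (LinearMap.flip B) (by
    intro c hc
    rw [LinearMap.mem_ker]
    ext x
    exact h2 c hc x))) (by
    intro c hc
    rw [LinearMap.mem_ker]
    ext x
    exact h1 c hc x)

theorem auxLift₂_apply {M : Type w} [AddCommGroup M] [Module F M] (K : Submodule F L)
    (B : L →ₗ[F] L →ₗ[F] M) (h1 : ∀ c ∈ K, ∀ x, B c x = 0) (h2 : ∀ c ∈ K, ∀ x, B x c = 0)
    (x y : L) : auxLift₂ K B h1 h2 (K.mkQ x) (K.mkQ y) = B x y := rfl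

/-- The core: invariant forms on a Killing Lie algebra are alternating. -/
theorem aux_alt {g : Type u} [LieRing g] [LieAlgebra F g] [FiniteDimensional F g]
    [LieAlgebra.IsKilling F g] (f : g →ₗ[F] g →ₗ[F] F)
    (hf : ∀ x y z, f x ⁅y, z⁆ = f ⁅x, y⁆ z + f y ⁅x, z⁆) (x : g) : f x x = 0 := by
  have hnd := LieAlgebra.IsKilling.killingForm_nondegenerate F g
  let e := LinearMap.BilinForm.toDual (killingForm F g) hnd
  have he : ∀ a z, killingForm F g (e.symm (f a)) z = f a z := by
    intro a z
    exact LinearMap.BilinForm.apply_toDual_symm_apply (hB := hnd) (f a) z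
  have hinv : ∀ a b c : g, killingForm F g ⁅a, b⁆ c = killingForm F g a ⁅b, c⁆ :=
    fun a b c => LieModule.traceForm_apply_lie_apply F g g a b c
  let D : LieDerivation F g g :=
    { toLinearMap := e.symm.toLinearMap ∘ₗ f
      leibniz' := by
        intro a b
        apply e.injective
        ext z
        change killingForm F g (e.symm (f ⁅a, b⁆)) z =
          killingForm F g (⁅a, e.symm (f b)⁆ - ⁅b, e.symm (f a)⁆) z
        rw [he, ← lie_skew a (e.symm (f b)), ← lie_skew b (e.symm (f a)), map_sub, LinearMap.sub_apply, map_neg, map_neg,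
          LinearMap.neg_apply, LinearMap.neg_apply, hinv, hinv, he, he, hf a b z]
        ring }
  obtain ⟨a, ha⟩ := LieDerivation.IsKilling.exists_eq_ad D
  have h1 : e.symm (f x) = ⁅a, x⁆ := by
    have : D x = ⁅a, x⁆ := by rw [← ha]; simp
    exact this
  rw [← he, h1, hinv, lie_self, map_zero]

end Aux

/-- Every finite-dimensional semi-simple left central Leibniz algebra
over a field of characteristic zero is a Lie algebra. -/
theorem semisimple_leftCentral_isLie (F : Type v) [Field F] [CharZero F]
    (L : Type u) [AddCommGroup L] [Module F L] [FiniteDimensional F L]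
    (mul : L → L → L) (hbil : IsBilinearMul F mul) (hleib : IsLeftLeibnizMul mul)
    (hss : IsSemisimpleLeibniz F mul)
    (hlc : ∀ c ∈ leibKer F mul, ∀ x : L, mul x c = 0) :
    ∀ x : L, mul x x = 0 := by
  obtain ⟨ha1, ha2, hs1, hs2⟩ := hbil
  let B : L →ₗ[F] L →ₗ[F] L := LinearMap.mk₂ F mul ha1 hs1 ha2 hs2
  have hB : ∀ x y, B x y = mul x y := fun _ _ => rfl
  let K := leibKer F mul
  have hsq : ∀ x, mul x x ∈ K := fun x => Submodule.subset_span ⟨x, rfl⟩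
  have hr : ∀ c ∈ K, ∀ x, B x c = 0 := hlc
  have hl : ∀ c ∈ K, ∀ x, B c x = 0 := by
    intro c hc y
    have : K ≤ LinearMap.ker (B.flip y) := by
      refine Submodule.span_le.2 ?_
      rintro _ ⟨x, rfl⟩
      have := hleib x x y
      simpa [hB] using this
    exact this hc
  let br := auxLift₂ K (B.compr₂ K.mkQ)
    (fun c hc x => by simp [hl c hc x]) (fun c hc x => by simp [hr c hc x])
  have hbr : ∀ x y, br (K.mkQ x) (K.mkQ y) = K.mkQ (mul x y) := fun _ _ => rfl
  have hsurj : ∀ q : L ⧸ K, ∃ x, K.mkQ x = q := K.mkQ_surjective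
  letI : LieRing (L ⧸ K) :=
    { bracket := fun x y => br x y
      add_lie := fun x y z => by change br _ _ = br _ _ + br _ _; simp
      lie_add := fun x y z => by change br _ _ = br _ _ + br _ _; simp
      lie_self := fun x => by
        obtain ⟨x, rfl⟩ := hsurj x
        change br _ _ = 0
        rw [hbr]
        exact (Submodule.Quotient.mk_eq_zero K).2 (hsq x)
      leibniz_lie := fun x y z => by
        obtain ⟨x, rfl⟩ := hsurj x
        obtain ⟨y, rfl⟩ := hsurj y
        obtain ⟨z, rfl⟩ := hsurj z
        change br _ (br _ _) = br (br _ _) _ + br _ (br _ _)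
        simp only [hbr]
        rw [hleib, map_add] }
  letI : LieAlgebra F (L ⧸ K) :=
    { lie_smul := fun t x y => by change br _ _ = t • br _ _; simp }
  have hlie : ∀ x y, ⁅K.mkQ x, K.mkQ y⁆ = K.mkQ (mul x y) := fun _ _ => rfl
  haveI : LieAlgebra.HasTrivialRadical F (L ⧸ K) := by
    rw [LieAlgebra.hasTrivialRadical_iff_no_abelian_ideals]
    intro I hI
    let J : Submodule F L := I.toSubmodule.comap K.mkQ
    have hJm : ∀ x, x ∈ J ↔ K.mkQ x ∈ I := fun _ => Iff.rfl
    have hJ : J ≤ K := by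
      apply hss J
      · intro x a ha
        rw [hJm] at ha
        rw [hJm, hJm, ← hlie, ← hlie]
        exact ⟨lie_mem_right F _ I _ _ ha, lie_mem_left F _ I _ _ ha⟩
      · refine ⟨2, ?_⟩
        have h1 : derSeries F mul J 1 ≤ K := by
          refine Submodule.span_le.2 ?_
          rintro _ ⟨a, ha, b, hb, rfl⟩
          have h0 : ⁅(⟨K.mkQ a, ha⟩ : I), (⟨K.mkQ b, hb⟩ : I)⁆ = 0 := hI.trivial _ _
          have h0' : ⁅K.mkQ a, K.mkQ b⁆ = 0 := congrArg Subtype.val h0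
          rw [hlie] at h0'
          exact (Submodule.Quotient.mk_eq_zero K).1 h0'
        rw [eq_bot_iff]
        refine Submodule.span_le.2 ?_
        rintro _ ⟨a, ha, b, hb, rfl⟩
        exact hlc b (h1 hb) a
    rw [LieSubmodule.eq_bot_iff]
    intro q hq
    obtain ⟨x, rfl⟩ := hsurj q
    exact (Submodule.Quotient.mk_eq_zero K).2 (hJ hq)
  haveI : FiniteDimensional F (L ⧸ K) := inferInstance
  intro x
  rw [← Module.forall_dual_apply_eq_zero_iff F]
  intro φ
  let f := auxLift₂ K (B.compr₂ φ)
    (fun c hc x => by simp [hl c hc x]) (fun c hc x => by simp [hr c hc x])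
  have hfa : ∀ x y, f (K.mkQ x) (K.mkQ y) = φ (mul x y) := fun _ _ => rfl
  have := aux_alt f (by
    intro x y z
    obtain ⟨x, rfl⟩ := hsurj x
    obtain ⟨y, rfl⟩ := hsurj y
    obtain ⟨z, rfl⟩ := hsurj z
    simp only [hlie, hfa]
    rw [hleib, map_add]) (K.mkQ x)
  rwa [hfa] at this
end
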